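/- arXiv:1308.2344 — 14 statements merged into one kernel-verified Lean document; each statement's English description precedes it below -/
import Mathlib

section
/- Let (G_n) be a sequence of finite groups (not necessarily abelian), with |G_n| → ∞. For each n let S be a subset of G_n chosen uniformly at random among all 2^{|G_n|} subsets. Then the probability that S·S = G_n and S·S^{-1} = G_n tends to 1 as n → ∞. Formally: for G : ℕ → Type with [∀ n, Group (G n)], [∀ n, Fintype (G n)], [∀ n, DecidableEq (G n)], if Fintype.card (G n) → ∞, then the ratio (number of finsets S of G n with S * S = Finset.univ and S / S = Finset.univ) / 2^(Fintype.card (G n)) tends to 1 as n → ∞. -/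
open Finset Filter
open scoped Pointwise

/-- Each pair `{x, f x}` with `x ∈ W` is avoided by at most three quarters of all sets, and at least
a third of these pairs can be chosen pairwise disjoint. -/
theorem card_avoiding_pairs_le {α : Type*} [DecidableEq α] (f : Equiv.Perm α) (k : ℕ)
    (U W : Finset α) (hW : ∀ x ∈ W, x ∈ U ∧ f x ∈ U) (hk : 3 * k ≤ #W) :
    4 ^ k * #{S ∈ U.powerset | ∀ x ∈ W, ¬(x ∈ S ∧ f x ∈ S)} ≤ 3 ^ k * 2 ^ #U := by
  induction k generalizing U W with
  | zero => simpa using card_filter_le U.powerset _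
  | succ k ih =>
    obtain ⟨x, hx⟩ : W.Nonempty := card_pos.mp (by omega)
    set P : Finset α := {x, f x} with hP
    have hPU : P ⊆ U := by
      intro y hy
      rcases mem_insert.mp hy with rfl | hy
      · exact (hW _ hx).1
      · rw [mem_singleton.mp hy]
        exact (hW _ hx).2
    have hPcard : #P = 1 ∨ #P = 2 := card_pair_eq_one_or_two
    set R : Finset α := {x, f x, f.symm x} with hR
    have hRcard : #R ≤ 3 := card_le_three
    have ih' := ih (U \ P) (W \ R)
      (by
        intro w hw
        simp only [hR, Finset.mem_sdiff, mem_insert, mem_singleton, not_or] at hw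
        obtain ⟨hwW, hwx, hwfx, hwsx⟩ := hw
        have hfw : f w ≠ x := fun h => hwsx (by rw [← h, Equiv.symm_apply_apply])
        simp [hP, hW w hwW, hwx, hwfx, hfw])
      (by have := le_card_sdiff R W; omega)
    set B' := {S ∈ (U \ P).powerset | ∀ x ∈ W \ R, ¬(x ∈ S ∧ f x ∈ S)} with hB'
    have hcard : #{S ∈ U.powerset | ∀ x ∈ W, ¬(x ∈ S ∧ f x ∈ S)} ≤ (2 ^ #P - 1) * #B' := by
      have hprod : #((P.powerset.erase P) ×ˢ B') = (2 ^ #P - 1) * #B' := by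
        rw [card_product, card_erase_of_mem (mem_powerset_self P), card_powerset]
      rw [← hprod]
      refine card_le_card_of_injOn (fun S => (S ∩ P, S \ P)) ?_ ?_
      · intro S hS
        simp only [coe_filter, mem_powerset, Set.mem_ofPred_eq] at hS
        simp only [coe_product, Set.mem_prod, mem_coe, mem_erase, mem_powerset, hB', mem_filter]
        refine ⟨⟨fun h => hS.2 x hx ?_, inter_subset_right⟩, sdiff_subset_sdiff hS.1 le_rfl, ?_⟩
        · have hPS : P ⊆ S := inter_eq_right.mp h
          exact ⟨hPS (by simp [hP]), hPS (by simp [hP])⟩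
        · intro y hy h
          exact hS.2 y (Finset.mem_sdiff.mp hy).1
            ⟨(Finset.mem_sdiff.mp h.1).1, (Finset.mem_sdiff.mp h.2).1⟩
      · intro S _ T _ h
        simp only [Prod.mk.injEq] at h
        rw [← sdiff_union_inter S P, ← sdiff_union_inter T P, h.1, h.2]
    have hpow : 2 ^ #U = 2 ^ #P * 2 ^ #(U \ P) := by
      rw [← pow_add, add_comm, card_sdiff_add_card_eq_card hPU]
    have hquarter : 4 * (2 ^ #P - 1) ≤ 3 * 2 ^ #P := by
      rcases hPcard with h | h <;> simp [h]
    calc 4 ^ (k + 1) * #{S ∈ U.powerset | ∀ x ∈ W, ¬(x ∈ S ∧ f x ∈ S)}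
        ≤ 4 ^ (k + 1) * ((2 ^ #P - 1) * #B') := by gcongr
      _ = (4 * (2 ^ #P - 1)) * (4 ^ k * #B') := by ring
      _ ≤ (3 * 2 ^ #P) * (3 ^ k * 2 ^ #(U \ P)) := Nat.mul_le_mul hquarter ih'
      _ = 3 ^ (k + 1) * 2 ^ #U := by rw [hpow]; ring

theorem card_not_balanced_le (H : Type*) [Group H] [Fintype H] [DecidableEq H] :
    4 ^ (Fintype.card H / 3) *
        #{S ∈ (univ : Finset H).powerset | ¬(S * S = univ ∧ S / S = univ)} ≤
      2 * Fintype.card H * (3 ^ (Fintype.card H / 3) * 2 ^ Fintype.card H) := by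
  set k := Fintype.card H / 3 with hk
  let avoiding (f : Equiv.Perm H) : Finset (Finset H) :=
    {S ∈ (univ : Finset H).powerset | ∀ x ∈ (univ : Finset H), ¬(x ∈ S ∧ f x ∈ S)}
  have havoiding (f : Equiv.Perm H) : 4 ^ k * #(avoiding f) ≤ 3 ^ k * 2 ^ Fintype.card H := by
    have h := card_avoiding_pairs_le f k univ univ (by simp) (by rw [card_univ]; omega)
    rw [card_univ] at h
    convert h
  have hsub : {S ∈ (univ : Finset H).powerset | ¬(S * S = univ ∧ S / S = univ)} ⊆
      univ.biUnion fun g : H =>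
        avoiding ((Equiv.inv H).trans (Equiv.mulRight g)) ∪ avoiding (Equiv.mulLeft g) := by
    intro S hS
    simp only [mem_filter, not_and_or, eq_univ_iff_forall, not_forall] at hS
    simp only [mem_biUnion, mem_univ, true_and, mem_union, avoiding, mem_filter, powerset_univ,
      forall_const]
    rcases hS.2 with ⟨g, hg⟩ | ⟨g, hg⟩
    · refine ⟨g, Or.inl fun x hx => hg ?_⟩
      exact mem_mul.mpr ⟨x, hx.1, x⁻¹ * g, hx.2, mul_inv_cancel_left x g⟩
    · refine ⟨g, Or.inr fun x hx => hg ?_⟩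
      exact mem_div.mpr ⟨g * x, hx.2, x, hx.1, mul_div_cancel_right g x⟩
  calc 4 ^ k * #{S ∈ (univ : Finset H).powerset | ¬(S * S = univ ∧ S / S = univ)}
      ≤ 4 ^ k * ∑ g : H, (#(avoiding ((Equiv.inv H).trans (Equiv.mulRight g))) +
          #(avoiding (Equiv.mulLeft g))) := by
        gcongr
        exact (card_le_card hsub).trans
          (card_biUnion_le.trans (sum_le_sum fun g _ => card_union_le _ _))
    _ = ∑ g : H, (4 ^ k * #(avoiding ((Equiv.inv H).trans (Equiv.mulRight g))) +
          4 ^ k * #(avoiding (Equiv.mulLeft g))) := by simp only [mul_sum, mul_add]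
    _ ≤ ∑ _g : H, (3 ^ k * 2 ^ Fintype.card H + 3 ^ k * 2 ^ Fintype.card H) :=
        sum_le_sum fun g _ => add_le_add (havoiding _) (havoiding _)
    _ = 2 * Fintype.card H * (3 ^ k * 2 ^ Fintype.card H) := by
        rw [sum_const, card_univ, smul_eq_mul]; ring

theorem one_sub_le_balanced_ratio (H : Type*) [Group H] [Fintype H] [DecidableEq H] :
    1 - 2 * (Fintype.card H : ℝ) * (3 / 4) ^ (Fintype.card H / 3) ≤
      (#{S ∈ (univ : Finset H).powerset | S * S = univ ∧ S / S = univ} : ℝ) /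
        2 ^ Fintype.card H := by
  have hbad : (4 : ℝ) ^ (Fintype.card H / 3) *
        #{S ∈ (univ : Finset H).powerset | ¬(S * S = univ ∧ S / S = univ)} ≤
      2 * Fintype.card H * (3 ^ (Fintype.card H / 3) * 2 ^ Fintype.card H) := by
    exact_mod_cast card_not_balanced_le H
  have hsum : (#{S ∈ (univ : Finset H).powerset | S * S = univ ∧ S / S = univ} : ℝ) +
      #{S ∈ (univ : Finset H).powerset | ¬(S * S = univ ∧ S / S = univ)} =
        2 ^ Fintype.card H := by
    have := card_filter_add_card_filter_not (s := (univ : Finset H).powerset)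
      (fun S => S * S = univ ∧ S / S = univ)
    rw [card_powerset, card_univ] at this
    exact_mod_cast this
  rw [← le_div_iff₀' (by positivity)] at hbad
  rw [le_div_iff₀ (by positivity), eq_sub_of_add_eq hsum, sub_mul, one_mul]
  refine sub_le_sub_left (hbad.trans_eq ?_) _
  rw [div_pow]
  ring

theorem tendsto_two_mul_mul_pow_div_three :
    Tendsto (fun n : ℕ => 2 * (n : ℝ) * (3 / 4) ^ (n / 3)) atTop (nhds 0) := by
  have hlim : Tendsto (fun k : ℕ => 6 * ((k : ℝ) * (3 / 4) ^ k) + 6 * (3 / 4 : ℝ) ^ k)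
      atTop (nhds 0) := by
    have h₁ := tendsto_self_mul_const_pow_of_lt_one (r := (3 / 4 : ℝ)) (by norm_num) (by norm_num)
    have h₂ := tendsto_pow_atTop_nhds_zero_of_lt_one (r := (3 / 4 : ℝ)) (by norm_num) (by norm_num)
    simpa using (h₁.const_mul 6).add (h₂.const_mul 6)
  refine squeeze_zero (fun n => by positivity) (fun n => ?_)
    (hlim.comp (Nat.tendsto_div_const_atTop (n := 3) (by norm_num)))
  have hn : (n : ℝ) ≤ 3 * ((n / 3 : ℕ) : ℝ) + 3 := by
    exact_mod_cast (by omega : n ≤ 3 * (n / 3) + 3)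
  calc 2 * (n : ℝ) * (3 / 4) ^ (n / 3)
      ≤ 2 * (3 * ((n / 3 : ℕ) : ℝ) + 3) * (3 / 4) ^ (n / 3) := by gcongr
    _ = 6 * (((n / 3 : ℕ) : ℝ) * (3 / 4) ^ (n / 3)) + 6 * (3 / 4) ^ (n / 3) := by ring

theorem most_subsets_balanced
    (G : ℕ → Type) [∀ n, Group (G n)] [∀ n, Fintype (G n)] [∀ n, DecidableEq (G n)]
    (hG : Tendsto (fun n => Fintype.card (G n)) atTop atTop) :
    Tendsto
      (fun n =>
        (((Finset.univ : Finset (G n)).powerset.filter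
            (fun S => S * S = Finset.univ ∧ S / S = Finset.univ)).card : ℝ)
          / 2 ^ (Fintype.card (G n)))
      atTop (nhds 1) := by
  have hlower := (tendsto_two_mul_mul_pow_div_three.comp hG).const_sub 1
  rw [sub_zero] at hlower
  refine tendsto_of_tendsto_of_tendsto_of_le_of_le hlower tendsto_const_nhds
    (fun n => one_sub_le_balanced_ratio (G n)) (fun n => ?_)
  refine div_le_one_of_le₀ ?_ (by positivity)
  have h := card_filter_le (univ : Finset (G n)).powerset
    (fun S => S * S = univ ∧ S / S = univ)
  rw [card_powerset, card_univ] at h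
  rw [← Nat.cast_le (α := ℝ), Nat.cast_pow, Nat.cast_ofNat] at h
  exact h
end

section
/- Let G be a finite group and g ∈ G. The number of subsets S of G such that g is not in the sumset S·S is at most 1.8^{|G|}. Formally: for a finite group G with decidable equality and g : G, ((Finset.univ.powerset.filter (fun S => g ∉ S * S)).card : ℝ) ≤ 1.8 ^ (Fintype.card G). Equivalently, for a uniformly random subset S of G, P(g ∉ S·S) ≤ (9/10)^{|G|}. -/
open Finset
open scoped Pointwise

section AvoidingSubsets

variable {α : Type*} [DecidableEq α] {f : α → α} {A B : Finset α} {x z : α}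

/-- The subsets of `A` that contain no element together with its image under `f`. -/
def avoidingSubsets (f : α → α) (A : Finset α) : Finset (Finset α) :=
  A.powerset.filter fun S => ∀ x ∈ S, f x ∉ S

/-- The points outside `A` that are images of points of `A` under `f`. -/
def escapingImage (f : α → α) (A : Finset α) : Finset α :=
  A.image f \ A

lemma mem_avoidingSubsets {S : Finset α} :
    S ∈ avoidingSubsets f A ↔ S ⊆ A ∧ ∀ x ∈ S, f x ∉ S := by
  simp [avoidingSubsets]

lemma card_avoidingSubsets_le_add
    (h : ∀ S ∈ avoidingSubsets f A, z ∈ S → S.erase z ⊆ B) :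
    #(avoidingSubsets f A) ≤ #(avoidingSubsets f (A.erase z)) + #(avoidingSubsets f B) := by
  rw [← card_filter_add_card_filter_not (s := avoidingSubsets f A) (fun S => z ∉ S)]
  refine Nat.add_le_add (card_le_card fun S hS => ?_)
    (card_le_card_of_injOn (fun S => S.erase z) (fun S hS => ?_) fun S hS T hT hST => ?_)
  · rw [mem_filter, mem_avoidingSubsets] at hS
    exact mem_avoidingSubsets.2 ⟨subset_erase.2 ⟨hS.1.1, hS.2⟩, hS.1.2⟩
  · simp only [coe_filter, Set.mem_ofPred_eq, not_not] at hS
    exact mem_avoidingSubsets.2 ⟨h S hS.1 hS.2, fun x hx hfx =>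
      (mem_avoidingSubsets.1 hS.1).2 x (mem_of_mem_erase hx) (mem_of_mem_erase hfx)⟩
  · simp only [coe_filter, Set.mem_ofPred_eq, not_not] at hS hT
    rw [← insert_erase hS.2, ← insert_erase hT.2]
    exact congrArg (insert z) hST

lemma card_avoidingSubsets_le_two_mul (x : α) :
    #(avoidingSubsets f A) ≤ 2 * #(avoidingSubsets f (A.erase x)) := by
  rw [two_mul]
  exact card_avoidingSubsets_le_add fun S hS _ =>
    erase_subset_erase x (mem_avoidingSubsets.1 hS).1

lemma card_avoidingSubsets_le_erase_add (x : α) :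
    #(avoidingSubsets f A) ≤
      #(avoidingSubsets f (A.erase (f x))) + #(avoidingSubsets f ((A.erase (f x)).erase x)) := by
  refine card_avoidingSubsets_le_add fun S hS hfx => ?_
  rw [mem_avoidingSubsets] at hS
  exact subset_erase.2 ⟨erase_subset_erase _ hS.1, fun hx => hS.2 x (mem_of_mem_erase hx) hfx⟩

lemma card_avoidingSubsets_le_of_fixed (hx : f x = x) :
    #(avoidingSubsets f A) ≤ #(avoidingSubsets f (A.erase x)) := by
  refine card_le_card fun S hS => ?_
  rw [mem_avoidingSubsets] at hS ⊢
  exact ⟨subset_erase.2 ⟨hS.1, fun h => hS.2 x h (by rwa [hx])⟩, hS.2⟩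

lemma card_escapingImage_erase_le_succ (x : α) :
    #(escapingImage f (A.erase x)) ≤ #(escapingImage f A) + 1 := by
  refine (card_le_card (t := insert x (escapingImage f A)) fun y hy => ?_).trans
    (card_insert_le _ _)
  simp only [escapingImage, mem_sdiff, mem_image, mem_erase, mem_insert] at hy ⊢
  grind

lemma card_escapingImage_erase_le (hf : f.Injective) (hx : x ∈ A) (hfx : f x ∉ A) :
    #(escapingImage f (A.erase x)) ≤ #(escapingImage f A) := by
  have hmem : f x ∈ escapingImage f A := mem_sdiff.2 ⟨mem_image_of_mem f hx, hfx⟩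
  rw [← card_erase_add_one hmem]
  refine (card_le_card (t := insert x ((escapingImage f A).erase (f x))) fun y hy => ?_).trans
    (card_insert_le _ _)
  simp only [escapingImage, mem_sdiff, mem_image, mem_erase, mem_insert] at hy ⊢
  grind [Function.Injective]

lemma card_escapingImage_erase_lt (hf : f.Injective) (hx : x ∈ A) (hfx : f x ∉ A)
    (h : ∀ y ∈ A, f y ≠ x) :
    #(escapingImage f (A.erase x)) < #(escapingImage f A) := by
  have hmem : f x ∈ escapingImage f A := mem_sdiff.2 ⟨mem_image_of_mem f hx, hfx⟩
  refine (card_le_card (t := (escapingImage f A).erase (f x)) fun y hy => ?_).trans_lt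
    (card_erase_lt_of_mem hmem)
  simp only [escapingImage, mem_sdiff, mem_image, mem_erase] at hy ⊢
  grind [Function.Injective]

/-- The weight `(10 / 9) ^ #(escapingImage f A)` is the price of each path component of the
functional graph of `f` on `A`; cycles are free. -/
theorem card_avoidingSubsets_le (hf : f.Injective) (A : Finset α) :
    (#(avoidingSubsets f A) : ℝ) ≤ (9 / 5) ^ #A * (10 / 9) ^ #(escapingImage f A) := by
  induction A using Finset.strongInduction with
  | H A ih =>
  have bound {B : Finset α} {m n : ℕ} (hBA : B ⊂ A) (hm : #B = m)
      (hn : #(escapingImage f B) ≤ n) :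
      (#(avoidingSubsets f B) : ℝ) ≤ (9 / 5) ^ m * (10 / 9) ^ n := by
    subst hm
    refine (ih B hBA).trans ?_
    gcongr
    norm_num
  have erase_two {y : α} {n : ℕ} (hy : y ∈ A) (hfy : f y ∈ A) (hne : f y ≠ y)
      (hn : #(escapingImage f (A.erase (f y))) ≤ n) :
      (#(avoidingSubsets f A) : ℝ) ≤ (9 / 5) ^ #A * ((70 / 81) * (10 / 9) ^ n) := by
    have hy' : y ∈ A.erase (f y) := mem_erase.2 ⟨hne.symm, hy⟩
    have c1 := card_erase_add_one hfy
    have c2 := card_erase_add_one hy'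
    have b1 := bound (erase_ssubset hfy) rfl hn
    have b2 := bound ((erase_ssubset hy').trans (erase_ssubset hfy)) rfl
      ((card_escapingImage_erase_le hf hy' (notMem_erase _ _)).trans hn)
    have h := Nat.cast_le (α := ℝ).2
      (card_avoidingSubsets_le_erase_add (f := f) (A := A) y)
    push_cast at h
    rw [← c2] at b1
    rw [← c1, ← c2]
    refine (h.trans (add_le_add b1 b2)).trans_eq ?_
    ring
  rcases (escapingImage f A).eq_empty_or_nonempty with hE | ⟨w, hw⟩
  · have hclosed : ∀ y ∈ A, f y ∈ A := fun y hy => by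
      rw [escapingImage, sdiff_eq_empty_iff_subset] at hE
      exact hE (mem_image_of_mem f hy)
    rw [hE, card_empty, pow_zero, mul_one]
    rcases A.eq_empty_or_nonempty with rfl | ⟨x, hx⟩
    · simp [avoidingSubsets, filter_singleton]
    by_cases hfx : f x = x
    · have hE' : #(escapingImage f (A.erase x)) ≤ 0 := by
        rw [Nat.le_zero, card_eq_zero, eq_empty_iff_forall_notMem]
        intro y hy
        simp only [escapingImage, mem_sdiff, mem_image, mem_erase] at hy
        grind [Function.Injective]
      have b := bound (erase_ssubset hx) rfl hE'
      have h := Nat.cast_le (α := ℝ).2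
        (card_avoidingSubsets_le_of_fixed (A := A) hfx)
      rw [pow_zero, mul_one] at b
      exact (h.trans b).trans (pow_le_pow_right₀ (by norm_num) (card_erase_le))
    · have hn : #(escapingImage f (A.erase (f x))) ≤ 1 := by
        simpa [hE] using card_escapingImage_erase_le_succ (f := f) (A := A) (f x)
      refine (erase_two hx (hclosed x hx) hfx hn).trans
        (mul_le_of_le_one_right (by positivity) (by norm_num))
  · obtain ⟨hwf, hwA⟩ := mem_sdiff.1 hw
    obtain ⟨x, hx, rfl⟩ := mem_image.1 hwf
    by_cases h : ∃ y ∈ A, f y = x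
    · obtain ⟨y, hy, rfl⟩ := h
      refine (erase_two hy hx (fun h => hwA (by rwa [h]))
        (card_escapingImage_erase_le hf hx hwA)).trans ?_
      gcongr
      exact mul_le_of_le_one_left (by positivity) (by norm_num)
    · push Not at h
      obtain ⟨n, hn⟩ := Nat.exists_eq_succ_of_ne_zero (card_ne_zero_of_mem hw)
      have hlt := card_escapingImage_erase_lt hf hx hwA h
      rw [hn, Nat.lt_succ_iff] at hlt
      have b := bound (erase_ssubset hx) rfl hlt
      have h2 := Nat.cast_le (α := ℝ).2
        (card_avoidingSubsets_le_two_mul (f := f) (A := A) x)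
      push_cast at h2
      rw [hn, ← card_erase_add_one hx, pow_succ, pow_succ]
      linarith

end AvoidingSubsets

theorem count_missing_sum_le
    (G : Type*) [Group G] [Fintype G] [DecidableEq G] (g : G) :
    (((Finset.univ : Finset G).powerset.filter (fun S => g ∉ S * S)).card : ℝ)
      ≤ 1.8 ^ (Fintype.card G) := by
  have hf : Function.Injective fun x : G => x⁻¹ * g := fun x y h => by simpa using h
  have hset : (univ : Finset G).powerset.filter (fun S => g ∉ S * S) =
      avoidingSubsets (fun x => x⁻¹ * g) univ := by
    ext S
    rw [mem_filter, mem_powerset, mem_avoidingSubsets, mem_mul]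
    push Not
    refine and_congr_right fun _ => ⟨fun h x hx hxg => ?_, fun h x hx y hy hxy => ?_⟩
    · exact h x hx _ hxg (mul_inv_cancel_left x g)
    · exact h x hx (by rwa [← hxy, inv_mul_cancel_left])
  have hE : escapingImage (fun x : G => x⁻¹ * g) univ = ∅ := by simp [escapingImage]
  have h := card_avoidingSubsets_le hf univ
  rw [hE, card_empty, pow_zero, mul_one, card_univ] at h
  rw [hset]
  norm_num at h ⊢
  exact h
end

section
/- Let G be a finite group and g ∈ G. The number of subsets S of G such that g is not in the difference set S·S^{-1} is at most 1.8^{|G|}. Formally: for a finite group G with decidable equality and g : G, ((Finset.univ.powerset.filter (fun S => g ∉ S / S)).card : ℝ) ≤ 1.8 ^ (Fintype.card G). Equivalently, for a uniformly random subset S of G, P(g ∉ S·S^{-1}) ≤ (9/10)^{|G|}. -/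
open Finset
open scoped Pointwise

section

variable {G : Type*} [Group G] [DecidableEq G]

/-- The subsets of `A` containing no pair `x, g * x`. -/
def shiftFree (g : G) (A : Finset G) : Finset (Finset G) :=
  A.powerset.filter fun S => ∀ x ∈ S, g * x ∉ S

theorem mem_shiftFree {g : G} {A S : Finset G} :
    S ∈ shiftFree g A ↔ S ⊆ A ∧ ∀ x ∈ S, g * x ∉ S := by
  simp [shiftFree]

theorem card_shiftFree_union_le (g : G) (A B : Finset G) :
    (shiftFree g (A ∪ B)).card ≤ (shiftFree g A).card * (shiftFree g B).card := by
  rw [← card_product]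
  refine card_le_card_of_injOn (fun S => (S ∩ A, S ∩ B)) ?_ ?_
  · intro S hS
    obtain ⟨-, hS⟩ := mem_shiftFree.1 hS
    simp only [coe_product, Set.mem_prod, mem_coe, mem_shiftFree]
    exact ⟨⟨inter_subset_right, by grind⟩, inter_subset_right, by grind⟩
  · intro S hS T hT h
    have hS := (mem_shiftFree.1 hS).1
    have hT := (mem_shiftFree.1 hT).1
    simp only [Prod.mk.injEq] at h
    rw [← inter_eq_left.2 hS, ← inter_eq_left.2 hT, inter_union_distrib_left,
      inter_union_distrib_left, h.1, h.2]

theorem card_shiftFree_pair_le (g x : G) : (shiftFree g {x, g * x}).card ≤ 3 := by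
  refine (card_le_card (t := {∅, {x}, {g * x}}) fun S hS => ?_).trans card_le_three
  obtain ⟨hS, h⟩ := mem_shiftFree.1 hS
  have hx := h x
  by_cases h1 : x ∈ S <;> by_cases h2 : g * x ∈ S <;> grind

theorem card_shiftFree_triple_le (g x : G) :
    (shiftFree g {x, g * x, g * (g * x)}).card ≤ 5 := by
  refine (card_le_card (t := {∅, {x}, {g * x}, {g * (g * x)}, {x, g * (g * x)}})
    fun S hS => ?_).trans card_le_five
  obtain ⟨hS, h⟩ := mem_shiftFree.1 hS
  have hx := h x
  have hy := h (g * x)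
  clear h
  generalize g * x = y at *
  generalize g * y = z at *
  simp only [mem_insert, mem_singleton, Finset.ext_iff, subset_iff, notMem_empty] at hS ⊢
  by_cases h2 : y ∈ S
  · exact .inr <| .inr <| .inl fun a => by have := @hS a; grind
  by_cases h1 : x ∈ S <;> by_cases h3 : z ∈ S
  · exact .inr <| .inr <| .inr <| .inr fun a => by have := @hS a; grind
  · exact .inr <| .inl fun a => by have := @hS a; grind
  · exact .inr <| .inr <| .inr <| .inl fun a => by have := @hS a; grind
  · exact .inl fun a => by have := @hS a; grind

theorem card_shiftFree_segment_le (g : G) (m : ℕ) (hm : 2 ≤ m) (x : G) :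
    ((shiftFree g ((range m).image fun i => g ^ i * x)).card : ℝ) ≤ 1.8 ^ m := by
  induction m using Nat.strong_induction_on generalizing x with
  | _ m ih =>
    obtain rfl | rfl | hm4 : m = 2 ∨ m = 3 ∨ 4 ≤ m := by omega
    · have h : (range 2).image (fun i => g ^ i * x) = {x, g * x} := by
        ext; simp [range_add_one]; grind
      rw [h]
      calc _ ≤ (3 : ℝ) := mod_cast card_shiftFree_pair_le g x
        _ ≤ _ := by norm_num
    · have h : (range 3).image (fun i => g ^ i * x) = {x, g * x, g * (g * x)} := by
        ext; simp [range_add_one, pow_two, mul_assoc]; grind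
      rw [h]
      calc _ ≤ (5 : ℝ) := mod_cast card_shiftFree_triple_le g x
        _ ≤ _ := by norm_num
    · obtain ⟨n, rfl⟩ : ∃ n, m = n + 2 := ⟨m - 2, by omega⟩
      have h : (range (n + 2)).image (fun i => g ^ i * x) =
          {x, g * x} ∪ (range n).image (fun i => g ^ i * (g * (g * x))) := by
        have hr : range (n + 2) = {0, 1} ∪ (range n).image (· + 2) := by
          ext i
          simp only [mem_range, mem_union, mem_insert, mem_singleton, mem_image]
          exact ⟨fun hi => or_iff_not_imp_left.2 fun _ => ⟨i - 2, by omega, by omega⟩, by grind⟩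
        rw [hr, image_union, image_image]
        simp [image_insert, Function.comp_def, pow_add, pow_two, mul_assoc]
      rw [h]
      calc _ ≤ ((shiftFree g {x, g * x}).card : ℝ) *
            (shiftFree g ((range n).image fun i => g ^ i * (g * (g * x)))).card :=
            mod_cast card_shiftFree_union_le _ _ _
        _ ≤ 3 * 1.8 ^ n := by
            gcongr
            · exact mod_cast card_shiftFree_pair_le g x
            · exact ih n (by omega) (by omega) _
        _ ≤ 1.8 ^ (n + 2) := by
            rw [pow_add, mul_comm]
            gcongr
            norm_num

theorem card_shiftFree_le {g : G} (hg : 2 ≤ orderOf g) (A : Finset G)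
    (hA : ∀ a ∈ A, g * a ∈ A) : ((shiftFree g A).card : ℝ) ≤ 1.8 ^ A.card := by
  induction A using Finset.strongInduction with
  | H A ih =>
    obtain rfl | ⟨x, hx⟩ := A.eq_empty_or_nonempty
    · simp [shiftFree, filter_singleton]
    set P := (range (orderOf g)).image fun i => g ^ i * x with hP
    have hfin : IsOfFinOrder g := orderOf_pos_iff.1 (by omega)
    have hmem (a : G) : a ∈ P ↔ a * x⁻¹ ∈ Subgroup.zpowers g := by
      rw [hfin.mem_zpowers_iff_mem_range_orderOf]
      simp [hP, eq_mul_inv_iff_mul_eq]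
    have hPA : P ⊆ A := by
      intro a ha
      obtain ⟨i, -, rfl⟩ := mem_image.1 ha
      induction i with
      | zero => simpa using hx
      | succ i hi =>
        rw [pow_succ', mul_assoc]
        refine hA _ (hi ?_)
        rw [hmem]
        simp
    have hcard : P.card = orderOf g := by
      rw [card_image_of_injOn, card_range]
      intro i hi j hj hij
      exact pow_injOn_Iio_orderOf (by simpa using hi) (by simpa using hj) (mul_right_cancel hij)
    have hxP : x ∈ P := by simp [hmem]
    have hB := ih (A \ P) (sdiff_ssubset hPA ⟨x, hxP⟩) fun a ha => by
      rw [mem_sdiff, hmem] at ha ⊢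
      rw [mul_assoc, Subgroup.mul_mem_cancel_left _ (Subgroup.mem_zpowers g)]
      exact ⟨hA a ha.1, ha.2⟩
    calc ((shiftFree g A).card : ℝ) = (shiftFree g (P ∪ A \ P)).card := by
          rw [union_sdiff_of_subset hPA]
      _ ≤ (shiftFree g P).card * (shiftFree g (A \ P)).card :=
          mod_cast card_shiftFree_union_le _ _ _
      _ ≤ 1.8 ^ P.card * 1.8 ^ (A \ P).card := by
          gcongr
          rw [hcard]
          exact card_shiftFree_segment_le g _ hg x
      _ = 1.8 ^ A.card := by rw [← pow_add, add_comm, card_sdiff_add_card_eq_card hPA]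

end

theorem count_missing_diff_le
    (G : Type*) [Group G] [Fintype G] [DecidableEq G] (g : G) :
    (((Finset.univ : Finset G).powerset.filter (fun S => g ∉ S / S)).card : ℝ)
      ≤ 1.8 ^ (Fintype.card G) := by
  obtain rfl | hg := eq_or_ne g 1
  · have h : (univ : Finset G).powerset.filter (fun S => (1 : G) ∉ S / S) ⊆ {∅} := by
      intro S hS
      simpa [mem_div, div_eq_one, eq_empty_iff_forall_notMem] using hS
    calc _ ≤ (1 : ℝ) := mod_cast card_le_card h
      _ ≤ _ := one_le_pow₀ (by norm_num)
  · have h2 : 2 ≤ orderOf g := by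
      have := orderOf_pos g
      have := mt orderOf_eq_one_iff.1 hg
      omega
    have h : (univ : Finset G).powerset.filter (fun S => g ∉ S / S) ⊆ shiftFree g univ := by
      intro S hS
      refine mem_shiftFree.2 ⟨subset_univ S, fun x hx hgx => (mem_filter.1 hS).2 ?_⟩
      exact mem_div.2 ⟨g * x, hgx, x, hx, mul_div_cancel_right g x⟩
    calc _ ≤ ((shiftFree g univ).card : ℝ) := mod_cast card_le_card h
      _ ≤ _ := card_shiftFree_le h2 univ fun _ _ => mem_univ _
end

section
/- Let G be a finite group and let S be a subset of G chosen uniformly at random. Then P(S·S ≠ G) ≤ |G|·(9/10)^{|G|}, and likewise P(S·S^{-1} ≠ G) ≤ |G|·(9/10)^{|G|}. Formally: for a finite group G with decidable equality, ((Finset.univ.powerset.filter (fun S => S * S ≠ Finset.univ)).card : ℝ) / 2 ^ (Fintype.card G) ≤ (Fintype.card G) * (9/10) ^ (Fintype.card G), and the same bound holds with S * S replaced by S / S. -/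
open Finset
open scoped Pointwise

section PermIndependent

variable {α : Type*} [DecidableEq α] (σ : Equiv.Perm α)

/-- The subsets of `V` containing no pair `a, σ a`, i.e. the independent subsets of `V` in the
functional graph of `σ`. -/
def permIndep (V : Finset α) : Finset (Finset α) :=
  V.powerset.filter fun S => ∀ a ∈ S, σ a ∉ S

/-- The elements of `V` whose image under `σ` leaves `V`: one for each path component of the
functional graph of `σ` restricted to `V`. -/
def permEnds (V : Finset α) : Finset α :=
  V.filter fun a => σ a ∉ V

variable {σ}

theorem mem_permIndep {V S : Finset α} :
    S ∈ permIndep σ V ↔ S ⊆ V ∧ ∀ a ∈ S, σ a ∉ S := by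
  simp [permIndep]

theorem mem_permEnds {V : Finset α} {a : α} : a ∈ permEnds σ V ↔ a ∈ V ∧ σ a ∉ V := by
  simp [permEnds]

theorem card_permIndep_le_of_fixed {V : Finset α} {x : α} (hx : σ x = x) :
    #(permIndep σ V) ≤ #(permIndep σ (V.erase x)) := by
  refine card_le_card fun S hS => ?_
  rw [mem_permIndep] at hS ⊢
  refine ⟨subset_erase.2 ⟨hS.1, fun hxS => hS.2 x hxS ?_⟩, hS.2⟩
  rwa [hx]

theorem card_permIndep_le_add (V : Finset α) {x y : α} (hy : σ y = x) :
    #(permIndep σ V) ≤ #(permIndep σ (V.erase x)) + #(permIndep σ ((V.erase x).erase y)) := by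
  rw [← card_filter_add_card_filter_not (s := permIndep σ V) (fun S => x ∉ S)]
  refine add_le_add (card_le_card fun S hS => ?_)
    (card_le_card_of_injOn (fun S => S.erase x) (fun S hS => ?_) fun S hS T hT h => ?_)
  · rw [mem_filter, mem_permIndep] at hS
    exact mem_permIndep.2 ⟨subset_erase.2 ⟨hS.1.1, hS.2⟩, hS.1.2⟩
  · rw [mem_coe, mem_filter, mem_permIndep, not_not] at hS
    obtain ⟨⟨hSV, hind⟩, hxS⟩ := hS
    have hyS : y ∉ S := fun h => hind y h (hy ▸ hxS)
    refine mem_permIndep.2 ⟨subset_erase.2 ⟨erase_subset_erase x hSV, fun h => ?_⟩,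
      fun a ha h => hind a (mem_of_mem_erase ha) (mem_of_mem_erase h)⟩
    exact hyS (mem_of_mem_erase h)
  · rw [mem_coe, mem_filter, not_not] at hS hT
    rw [← insert_erase hS.2, ← insert_erase hT.2]
    exact congrArg (insert x) h

theorem permEnds_erase_subset (V : Finset α) {x y : α} (hy : σ y = x) :
    permEnds σ (V.erase x) ⊆ insert y ((permEnds σ V).erase x) := by
  intro a ha
  simp only [mem_insert, mem_erase, mem_permEnds] at ha ⊢
  by_cases h : σ a = x
  · exact Or.inl (σ.injective (h.trans hy.symm))
  · tauto

theorem card_permIndep_le (V : Finset α) :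
    (#(permIndep σ V) : ℝ) ≤ (9 / 5) ^ #V * (10 / 9) ^ #(permEnds σ V) := by
  induction V using Finset.strongInduction with
  | H V ih =>
    rcases V.eq_empty_or_nonempty with rfl | hV
    · simp [permIndep, permEnds, filter_singleton]
    obtain ⟨x, hxV, hx⟩ : ∃ x ∈ V, x ∈ permEnds σ V ∨ permEnds σ V = ∅ := by
      rcases (permEnds σ V).eq_empty_or_nonempty with h | ⟨x, hx⟩
      · exact hV.imp fun x hx => ⟨hx, Or.inr h⟩
      · exact ⟨x, (mem_permEnds.1 hx).1, Or.inl hx⟩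
    obtain ⟨y, hy⟩ := σ.surjective x
    have hcard : #V = #(V.erase x) + 1 := (card_erase_add_one hxV).symm
    have hends := permEnds_erase_subset V hy
    have ih₁ := ih _ (erase_ssubset hxV)
    have hadd : (#(permIndep σ V) : ℝ) ≤
        #(permIndep σ (V.erase x)) + #(permIndep σ ((V.erase x).erase y)) := by
      exact_mod_cast card_permIndep_le_add V hy
    by_cases hyV : y ∈ V.erase x
    · have hcard' : #(V.erase x) = #((V.erase x).erase y) + 1 := (card_erase_add_one hyV).symm
      have ih₂ := ih _ ((erase_ssubset hyV).trans (erase_ssubset hxV))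
      obtain ⟨z, hz⟩ := σ.surjective y
      have hends₂ : permEnds σ ((V.erase x).erase y) ⊆ insert z ((permEnds σ V).erase x) := by
        refine (permEnds_erase_subset _ hz).trans (insert_subset_insert z fun a ha => ?_)
        exact (mem_insert.1 (hends (mem_of_mem_erase ha))).resolve_left (ne_of_mem_erase ha)
      have hc₁ := (card_le_card hends).trans (card_insert_le _ _)
      have hc₂ := (card_le_card hends₂).trans (card_insert_le _ _)
      have hone : (1 : ℝ) ≤ 10 / 9 := by norm_num
      rw [hcard'] at ih₁
      rw [hcard, hcard']
      set m := #((V.erase x).erase y)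
      have hp : (0 : ℝ) < (9 / 5) ^ m := by positivity
      rcases hx with hx | hx
      · rw [card_erase_add_one hx] at hc₁ hc₂
        have h₁ := mul_le_mul_of_nonneg_left (pow_le_pow_right₀ hone hc₁)
          (by positivity : (0 : ℝ) ≤ (9 / 5) ^ (m + 1))
        have h₂ := mul_le_mul_of_nonneg_left (pow_le_pow_right₀ hone hc₂) hp.le
        have hq : (0 : ℝ) < (9 / 5) ^ m * (10 / 9) ^ #(permEnds σ V) := by positivity
        rw [pow_succ] at h₁ ih₁
        rw [pow_succ, pow_succ]
        linarith
      · rw [hx, erase_empty, card_empty, zero_add] at hc₁ hc₂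
        have h₁ := mul_le_mul_of_nonneg_left (pow_le_pow_right₀ hone hc₁)
          (by positivity : (0 : ℝ) ≤ (9 / 5) ^ (m + 1))
        have h₂ := mul_le_mul_of_nonneg_left (pow_le_pow_right₀ hone hc₂) hp.le
        rw [pow_succ] at h₁ ih₁
        rw [hx, pow_succ, pow_succ, card_empty, pow_zero]
        linarith
    · rcases eq_or_ne y x with rfl | hyx
      · have hnot : y ∉ permEnds σ V := fun h => (mem_permEnds.1 h).2 (by rwa [hy])
        have hempty := hx.resolve_left hnot
        rw [hempty, erase_empty] at hends
        have hends' : permEnds σ (V.erase y) = ∅ := by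
          refine eq_empty_of_forall_notMem fun a ha => ?_
          rw [mem_singleton.1 (hends ha), mem_permEnds] at ha
          exact notMem_erase y V ha.1
        have hle : (#(permIndep σ V) : ℝ) ≤ #(permIndep σ (V.erase y)) := by
          exact_mod_cast card_permIndep_le_of_fixed hy
        rw [hends', card_empty, pow_zero] at ih₁
        rw [hempty, hcard, card_empty, pow_zero, pow_succ]
        have hp : (0 : ℝ) < (9 / 5) ^ #(V.erase y) := by positivity
        linarith
      · rw [erase_eq_of_notMem hyV] at hadd
        have hyV' : y ∉ V := fun h => hyV (mem_erase.2 ⟨hyx, h⟩)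
        have hx' : x ∈ permEnds σ V := by
          refine hx.resolve_right fun h => hyV' ?_
          have hsub : V.map σ.toEmbedding ⊆ V := fun b hb => by
            obtain ⟨a, ha, rfl⟩ := mem_map.1 hb
            by_contra hc
            exact notMem_empty a (h ▸ mem_permEnds.2 ⟨ha, hc⟩)
          rw [← eq_of_subset_of_card_le hsub (card_map _).ge] at hxV
          obtain ⟨a, ha, hax⟩ := mem_map.1 hxV
          rwa [← σ.injective (hax.trans hy.symm)]
        have hends' : permEnds σ (V.erase x) ⊆ (permEnds σ V).erase x := fun a ha =>
          (mem_insert.1 (hends ha)).resolve_left fun h =>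
            hyV (h ▸ (mem_permEnds.1 ha).1)
        have h₁ := mul_le_mul_of_nonneg_left
          (pow_le_pow_right₀ (by norm_num : (1 : ℝ) ≤ 10 / 9) (card_le_card hends'))
          (by positivity : (0 : ℝ) ≤ (9 / 5) ^ #(V.erase x))
        rw [hcard, ← card_erase_add_one hx', pow_succ, pow_succ]
        linarith

theorem card_permIndep_univ_le [Fintype α] (σ : Equiv.Perm α) :
    (#(permIndep σ univ) : ℝ) ≤ (9 / 5) ^ Fintype.card α := by
  simpa [permEnds] using card_permIndep_le (σ := σ) univ

/-- If every subset satisfying `p` is independent for one of the permutations `τ g`, then `p` has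
probability at most `|α| (9 / 10) ^ |α|`. -/
theorem card_filter_div_le [Fintype α] (τ : α → Equiv.Perm α) (p : Finset α → Prop)
    [DecidablePred p] (hp : ∀ S, p S → ∃ g, ∀ a ∈ S, τ g a ∉ S) :
    (#((univ : Finset α).powerset.filter p) : ℝ) / 2 ^ Fintype.card α
      ≤ Fintype.card α * (9 / 10) ^ Fintype.card α := by
  have hsub : (univ : Finset α).powerset.filter p ⊆
      univ.biUnion fun g => permIndep (τ g) univ := fun S hS => by
    obtain ⟨g, hg⟩ := hp S (mem_filter.1 hS).2
    exact mem_biUnion.2 ⟨g, mem_univ g, mem_permIndep.2 ⟨subset_univ S, hg⟩⟩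
  have hle : (#((univ : Finset α).powerset.filter p) : ℝ) ≤ ∑ g, (#(permIndep (τ g) univ) : ℝ) := by
    exact_mod_cast (card_le_card hsub).trans card_biUnion_le
  rw [div_le_iff₀ (by positivity), mul_assoc, ← mul_pow]
  refine hle.trans ((sum_le_sum fun g _ => card_permIndep_univ_le (τ g)).trans_eq ?_)
  rw [sum_const, card_univ, nsmul_eq_mul]
  norm_num

end PermIndependent

theorem prob_not_whole_group_le
    (G : Type*) [Group G] [Fintype G] [DecidableEq G] :
    (((Finset.univ : Finset G).powerset.filter
        (fun S => S * S ≠ Finset.univ)).card : ℝ) / 2 ^ (Fintype.card G)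
      ≤ (Fintype.card G) * (9 / 10) ^ (Fintype.card G)
    ∧
    (((Finset.univ : Finset G).powerset.filter
        (fun S => S / S ≠ Finset.univ)).card : ℝ) / 2 ^ (Fintype.card G)
      ≤ (Fintype.card G) * (9 / 10) ^ (Fintype.card G) := by
  refine ⟨card_filter_div_le (fun g => (Equiv.inv G).trans (Equiv.mulRight g)) _ fun S hS => ?_,
    card_filter_div_le (fun g => Equiv.mulLeft g) _ fun S hS => ?_⟩
  all_goals
    obtain ⟨g, hg⟩ := not_forall.1 (mt eq_univ_iff_forall.2 hS)
    refine ⟨g, fun a ha h => hg ?_⟩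
  · exact mem_mul.2 ⟨a, ha, _, h, by simp⟩
  · exact mem_div.2 ⟨_, h, a, ha, by simp⟩
end

section
/- For n ≥ 1, the number of ways to color the vertices of a closed chain (cycle) of n vertices red or blue so that no two adjacent vertices are both red equals the n-th Lucas number L(n) = F(n+1) + F(n-1), where F is the Fibonacci sequence. Formally: for n ≥ 1, the number of subsets S of ZMod n such that there is no i : ZMod n with both i ∈ S and i + 1 ∈ S equals Nat.fib (n+1) + Nat.fib (n-1). -/
open Finset

theorem card_filter_powerset_insert {α : Type*} [DecidableEq α] {s : Finset α} {a : α}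
    (ha : a ∉ s) (p : Finset α → Prop) [DecidablePred p] :
    #{S ∈ (insert a s).powerset | p S} =
      #{S ∈ s.powerset | p S} + #{S ∈ s.powerset | p (insert a S)} := by
  rw [powerset_insert, filter_union, card_union_of_disjoint, filter_image, card_image_of_injOn]
  · intro S hS T hT h
    simp only [coe_filter, mem_powerset, Set.mem_ofPred_eq] at hS hT
    rw [← erase_insert (fun h => ha (hS.1 h)), ← erase_insert (fun h => ha (hT.1 h))]
    exact congrArg (·.erase a) h
  · rw [disjoint_left]
    grind

theorem forall_mem_insert_succ_notMem_iff {S : Finset ℕ} {t : ℕ} (hS : ∀ i ∈ S, i < t) :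
    (∀ i ∈ insert t S, i + 1 ∉ insert t S) ↔ ∀ i ∈ S, i + 1 ∉ S ∧ i + 1 < t := by
  have ht : t + 1 ∉ S := fun h => absurd (hS _ h) (by omega)
  rw [forall_mem_insert]
  simp only [mem_insert, not_or]
  refine ⟨fun h i hi => ⟨(h.2 i hi).2, ?_⟩, fun h => ⟨⟨by omega, ht⟩, fun i hi => ⟨?_, (h i hi).1⟩⟩⟩
  · have := hS i hi
    have := (h.2 i hi).1
    omega
  · exact (h i hi).2.ne

/-- The subsets of `{a, …, a + m - 1}` containing no two consecutive integers. -/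
def sparseSubsets (a m : ℕ) : Finset (Finset ℕ) :=
  {S ∈ (Ico a (a + m)).powerset | ∀ i ∈ S, i + 1 ∉ S}

theorem card_sparseSubsets (a m : ℕ) : #(sparseSubsets a m) = Nat.fib (m + 2) := by
  induction m using Nat.twoStepInduction with
  | zero => simp [sparseSubsets, filter_singleton]
  | one =>
    rw [sparseSubsets, Nat.Ico_succ_singleton, ← insert_empty_eq,
      card_filter_powerset_insert (notMem_empty a)]
    simp [filter_singleton, Nat.fib_add_two]
  | more m ih₀ ih₁ =>
    have hI : Ico a (a + (m + 2)) = insert (a + m + 1) (Ico a (a + (m + 1))) := by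
      ext; simp only [mem_insert, mem_Ico]; omega
    have hS : {S ∈ (Ico a (a + (m + 1))).powerset |
        ∀ i ∈ insert (a + m + 1) S, i + 1 ∉ insert (a + m + 1) S} = sparseSubsets a m := by
      ext S
      simp only [sparseSubsets, mem_filter, mem_powerset, subset_iff, mem_Ico]
      constructor
      · rintro ⟨hb, hs⟩
        rw [forall_mem_insert_succ_notMem_iff fun i hi => by have := hb hi; omega] at hs
        exact ⟨fun i hi => ⟨(hb hi).1, by have := (hs i hi).2; omega⟩, fun i hi => (hs i hi).1⟩
      · rintro ⟨hb, hs⟩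
        rw [forall_mem_insert_succ_notMem_iff fun i hi => by have := hb hi; omega]
        exact ⟨fun i hi => by have := hb hi; omega,
          fun i hi => ⟨hs i hi, by have := hb hi; omega⟩⟩
    rw [Nat.fib_add_two, ← ih₀, ← ih₁, add_comm (#(sparseSubsets a m)), ← hS]
    simp only [sparseSubsets]
    rw [hI, card_filter_powerset_insert (by simp; omega)]

theorem card_cyclically_sparse (m : ℕ) :
    #{S ∈ (range (m + 1)).powerset | (∀ i ∈ S, i + 1 ∉ S) ∧ ¬ (m ∈ S ∧ 0 ∈ S)} =
      Nat.fib (m + 2) + Nat.fib m := by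
  have h₀ : {S ∈ (range m).powerset | (∀ i ∈ S, i + 1 ∉ S) ∧ ¬ (m ∈ S ∧ 0 ∈ S)} =
      sparseSubsets 0 m := by
    ext S
    simp only [sparseSubsets, mem_filter, mem_powerset, subset_iff, mem_Ico, mem_range]
    grind
  rw [range_add_one, card_filter_powerset_insert (by simp), h₀, card_sparseSubsets]
  congr 1
  match m with
  | 0 => simp
  | 1 => decide
  | k + 2 =>
    rw [← card_sparseSubsets 1 k]
    congr 1
    ext S
    simp only [sparseSubsets, mem_filter, mem_powerset, subset_iff, mem_Ico, mem_range]
    constructor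
    · rintro ⟨hb, hs, h0⟩
      rw [forall_mem_insert_succ_notMem_iff fun i hi => hb hi] at hs
      refine ⟨fun i hi => ⟨?_, by have := (hs i hi).2; omega⟩, fun i hi => (hs i hi).1⟩
      by_contra hi0
      obtain rfl : i = 0 := by omega
      exact h0 ⟨mem_insert_self _ _, mem_insert_of_mem hi⟩
    · rintro ⟨hb, hs⟩
      rw [forall_mem_insert_succ_notMem_iff fun i hi => by have := hb hi; omega]
      refine ⟨fun i hi => by have := hb hi; omega,
        fun i hi => ⟨hs i hi, by have := hb hi; omega⟩, ?_⟩
      rintro ⟨-, h⟩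
      have := hb ((mem_insert.1 h).resolve_left (by omega))
      omega

theorem cycle_independent_sets_eq_lucas (n : ℕ) [NeZero n] :
    ((Finset.univ : Finset (ZMod n)).powerset.filter
        (fun S => ¬ ∃ i : ZMod n, i ∈ S ∧ i + 1 ∈ S)).card
      = Nat.fib (n + 1) + Nat.fib (n - 1) := by
  obtain ⟨m, rfl⟩ := Nat.exists_eq_succ_of_ne_zero (NeZero.ne n)
  refine Eq.trans ?_ (card_cyclically_sparse m)
  let e : ZMod (m + 1) ↪ ℕ := ⟨ZMod.val, ZMod.val_injective (m + 1)⟩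
  have hlt (i : ZMod (m + 1)) : e i < m + 1 := ZMod.val_lt i
  have hsurj (k : ℕ) (hk : k < m + 1) : ∃ i, e i = k := ⟨k, ZMod.val_cast_of_lt hk⟩
  have hadd (i : ZMod (m + 1)) : e (i + 1) = if e i = m then 0 else e i + 1 := by
    have h : e (i + 1) = (e i + 1) % (m + 1) := by
      change (i + 1).val = (i.val + 1) % (m + 1)
      rw [ZMod.val_add, ZMod.val_one_eq_one_mod, Nat.add_mod_mod]
    rw [h]
    split_ifs with hi
    · rw [hi, Nat.mod_self]
    · exact Nat.mod_eq_of_lt (by have := hlt i; omega)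
  have hsub (S : Finset (ZMod (m + 1))) : ∀ k ∈ S.map e, k < m + 1 := by
    simpa using fun i _ => hlt i
  have hiff (S : Finset (ZMod (m + 1))) : (¬ ∃ i, i ∈ S ∧ i + 1 ∈ S) ↔
      (∀ k ∈ S.map e, k + 1 ∉ S.map e) ∧ ¬ (m ∈ S.map e ∧ 0 ∈ S.map e) := by
    have hmem (i : ZMod (m + 1)) : i ∈ S ↔ e i ∈ S.map e := (mem_map' e).symm
    simp only [hmem, hadd]
    constructor
    · intro h
      refine ⟨fun k hk hk' => ?_, fun hm => ?_⟩
      · obtain ⟨i, rfl⟩ := hsurj k (hsub S k hk)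
        have := hsub S _ hk'
        exact h ⟨i, hk, by rwa [if_neg (by omega)]⟩
      · obtain ⟨i, hi⟩ := hsurj m (by omega)
        exact h ⟨i, by rw [hi]; exact hm.1, by rw [if_pos hi]; exact hm.2⟩
    · rintro ⟨h, h'⟩ ⟨i, hi, hi'⟩
      split_ifs at hi' with him
      · exact h' ⟨by rwa [him] at hi, hi'⟩
      · exact h _ hi hi'
  refine card_bij (fun S _ => S.map e) ?_ ?_ ?_
  · intro S hS
    simp only [mem_filter, mem_powerset, subset_iff, mem_range] at hS ⊢
    exact ⟨hsub S, (hiff S).1 hS.2⟩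
  · exact fun S _ T _ h => map_injective _ h
  · intro T hT
    simp only [mem_filter, mem_powerset, subset_iff, mem_range] at hT
    have hTmap : ({i | e i ∈ T} : Finset (ZMod (m + 1))).map e = T := by
      ext k
      simp only [mem_map, mem_filter, mem_univ, true_and]
      refine ⟨fun ⟨j, hj, h⟩ => h ▸ hj, fun hk => ?_⟩
      obtain ⟨i, rfl⟩ := hsurj k (hT.1 hk)
      exact ⟨i, hk, rfl⟩
    refine ⟨_, ?_, hTmap⟩
    rw [mem_filter, hiff, hTmap]
    exact ⟨by simp, hT.2⟩
end

section
/- Let n be even with n ≥ 2, and let k ∈ ℤ/nℤ be even, i.e., k = m + m for some m ∈ ℤ/nℤ. Then the number of subsets S of ℤ/nℤ with k ∉ S + S equals 3^{(n-2)/2}. Equivalently, for a uniformly random subset S of ℤ/nℤ, P(k ∉ S + S) = (1/2)^2 · (3/4)^{n/2 - 1}. -/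
open Finset
open scoped Pointwise

/-- Among the subsets of a finite set stable under an involution `σ`, those that never contain
both `x` and `σ x` number `3` to the number of two-element orbits. -/
theorem card_filter_involution_free_sq {α : Type*} [DecidableEq α] {σ : α → α}
    (hσ : Function.Involutive σ) (A : Finset α) (hA : ∀ x ∈ A, σ x ∈ A) :
    (#{S ∈ A.powerset | ∀ x ∈ S, σ x ∉ S}) ^ 2 = 3 ^ #{x ∈ A | σ x ≠ x} := by
  induction A using Finset.strongInduction with
  | H A ih =>
  by_cases hfix : ∀ x ∈ A, σ x = x
  · have h₁ : {S ∈ A.powerset | ∀ x ∈ S, σ x ∉ S} = {∅} := by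
      ext S
      simp only [mem_filter, mem_powerset, mem_singleton]
      constructor
      · rintro ⟨hSA, hS⟩
        refine eq_empty_of_forall_notMem fun x hx => hS x hx ?_
        rwa [hfix x (hSA hx)]
      · rintro rfl
        simp
    have h₂ : {x ∈ A | σ x ≠ x} = ∅ := by
      simpa [filter_eq_empty_iff] using hfix
    rw [h₁, h₂]
    simp
  · push Not at hfix
    obtain ⟨x, hxA, hx⟩ := hfix
    set B := (A.erase x).erase (σ x) with hB
    have hxB : x ∉ B := by simp [hB]
    have hyB : σ x ∉ B := by simp [hB]
    have hxyB : x ∉ insert (σ x) B := by simp [hxB, hx.symm]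
    have hAB : A = insert x (insert (σ x) B) := by
      rw [hB, insert_erase (mem_erase.2 ⟨hx, hA x hxA⟩), insert_erase hxA]
    have hBA : B ⊂ A := Finset.ssubset_iff_subset_ne.2
      ⟨(erase_subset _ _).trans (erase_subset _ _), fun h => hxB (h ▸ hxA)⟩
    have hBσ : ∀ z ∈ B, σ z ∈ B := by
      intro z hz
      simp only [hB, mem_erase] at hz ⊢
      exact ⟨fun h => hz.2.1 (hσ.injective h),
        fun h => hz.1 (by rw [← h, hσ z]), hA z hz.2.2⟩
    have hσB : ∀ z, σ z = x → z = σ x := fun z h => by rw [← h, hσ z]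
    have hcount : #{S ∈ A.powerset | ∀ x ∈ S, σ x ∉ S}
        = 3 * #{S ∈ B.powerset | ∀ x ∈ S, σ x ∉ S} := by
      simp only [card_filter]
      rw [hAB, sum_powerset_insert hxyB, sum_powerset_insert hyB, sum_powerset_insert hyB,
        ← sum_add_distrib, ← sum_add_distrib, ← sum_add_distrib, mul_sum]
      refine sum_congr rfl fun t ht => ?_
      rw [mem_powerset] at ht
      have hxt : x ∉ t := fun h => hxB (ht h)
      have hyt : σ x ∉ t := fun h => hyB (ht h)
      have hxx := hσ x
      have e₁ : (∀ z ∈ insert (σ x) t, σ z ∉ insert (σ x) t) ↔ ∀ z ∈ t, σ z ∉ t := by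
        simp only [mem_insert, forall_eq_or_imp, not_or, hxx]
        exact ⟨fun h z hz => (h.2 z hz).2, fun h => ⟨⟨hx.symm, hxt⟩, fun z hz =>
          ⟨fun e => hxt (hσ.injective e ▸ hz), h z hz⟩⟩⟩
      have e₂ : (∀ z ∈ insert x t, σ z ∉ insert x t) ↔ ∀ z ∈ t, σ z ∉ t := by
        simp only [mem_insert, forall_eq_or_imp, not_or]
        exact ⟨fun h z hz => (h.2 z hz).2, fun h => ⟨⟨hx, hyt⟩, fun z hz =>
          ⟨fun e => hyt (hσB z e ▸ hz), h z hz⟩⟩⟩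
      have e₃ : ¬ ∀ z ∈ insert x (insert (σ x) t), σ z ∉ insert x (insert (σ x) t) :=
        fun h => h x (by simp) (by simp)
      simp only [e₁, e₂, if_neg e₃]
      ring
    have hexp : #{z ∈ A | σ z ≠ z} = #{z ∈ B | σ z ≠ z} + 2 := by
      rw [hAB, filter_insert, if_pos hx, filter_insert, if_pos (by rw [hσ x]; exact hx.symm),
        card_insert_of_notMem (by simp [hxB, hx.symm]), card_insert_of_notMem (by simp [hyB])]
    rw [hcount, hexp, mul_pow, ih B hBA hBσ]
    ring

/-- In `ZMod (h + h)` with `h ≠ 0` the elements killed by doubling are `0` and `h`. -/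
theorem ZMod.add_self_eq_zero_iff_of_even {n h : ℕ} [NeZero n] (hn : n = h + h) (d : ZMod n) :
    d + d = 0 ↔ d = 0 ∨ d = (h : ZMod n) := by
  constructor
  · intro hd
    have hlt := ZMod.val_lt d
    have hdvd : n ∣ d.val + d.val := by
      rw [← ZMod.natCast_eq_zero_iff]
      push_cast
      simpa using hd
    obtain ⟨c, hc⟩ := hdvd
    have hc2 : c < 2 := by
      by_contra! hcon
      have := Nat.mul_le_mul_left n hcon
      omega
    rw [← ZMod.natCast_zmod_val d]
    interval_cases c
    · left
      rw [show d.val = 0 by omega, Nat.cast_zero]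
    · right
      rw [show d.val = h by omega]
  · rintro (rfl | rfl)
    · simp
    · rw [← Nat.cast_add, ← hn, ZMod.natCast_self]

theorem count_missing_even_sum (n : ℕ) [NeZero n] (hn : 2 ≤ n) (hne : Even n)
    (k : ZMod n) (hk : ∃ m : ZMod n, m + m = k) :
    ((Finset.univ : Finset (ZMod n)).powerset.filter
        (fun S => k ∉ S + S)).card = 3 ^ ((n - 2) / 2) := by
  obtain ⟨m, rfl⟩ := hk
  obtain ⟨h, hh⟩ := hne
  have hσ : Function.Involutive fun x : ZMod n => m + m - x := fun x => sub_sub_cancel _ _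
  have hmem : ∀ S : Finset (ZMod n), m + m ∉ S + S ↔ ∀ x ∈ S, m + m - x ∉ S := by
    intro S
    simp only [mem_add, not_exists, not_and]
    exact ⟨fun H x hx hy => H x hx _ hy (add_sub_cancel _ _),
      fun H x hx y hy e => H x hx (by rwa [← e, add_sub_cancel_left])⟩
  have hh0 : (h : ZMod n) ≠ 0 := by
    rw [Ne, ZMod.natCast_eq_zero_iff]
    exact fun hd => absurd (Nat.le_of_dvd (by omega) hd) (by omega)
  have hfixed : ({x : ZMod n | m + m - x ≠ x} : Finset (ZMod n)) = {m, m + h}ᶜ := by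
    ext x
    have hx : m + m - x = x ↔ x = m ∨ x = m + h := by
      rw [← sub_eq_zero (a := x) (b := m), ← sub_eq_iff_eq_add',
        ← ZMod.add_self_eq_zero_iff_of_even hh]
      constructor <;> intro e <;> linear_combination -e
    simp [hx]
  have key := card_filter_involution_free_sq hσ univ fun _ _ => mem_univ _
  rw [hfixed, card_compl, ZMod.card, card_pair (by simpa using hh0),
    show n - 2 = (n - 2) / 2 * 2 by omega, pow_mul] at key
  rw [← Nat.pow_left_injective two_ne_zero key]
  exact congrArg card (by ext S; simp only [mem_filter, hmem])
end

section
/- Let n be even with n ≥ 2, and let k ∈ ℤ/nℤ be odd, i.e., there is no m ∈ ℤ/nℤ with k = m + m. Then the number of subsets S of ℤ/nℤ with k ∉ S + S equals 3^{n/2}. Equivalently, for a uniformly random subset S of ℤ/nℤ, P(k ∉ S + S) = (3/4)^{n/2}. -/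
theorem card_filter_powerset_involution_free {α : Type*} [DecidableEq α] {σ : α → α}
    (hσ : Function.Involutive σ) (hfix : ∀ x, σ x ≠ x) (m : ℕ) (T : Finset α)
    (hT : ∀ x ∈ T, σ x ∈ T) (hcard : T.card = 2 * m) :
    (T.powerset.filter (fun S => ∀ x ∈ S, σ x ∉ S)).card = 3 ^ m := by
  induction m generalizing T with
  | zero =>
    obtain rfl : T = ∅ := by simpa using hcard
    simp [Finset.filter_singleton]
  | succ m ih =>
    obtain ⟨a, ha⟩ : T.Nonempty := Finset.card_pos.mp (by omega)
    obtain ⟨U, hU⟩ : ∃ U, U = (T.erase a).erase (σ a) := ⟨_, rfl⟩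
    have hb : σ a ∈ T.erase a := Finset.mem_erase.mpr ⟨hfix a, hT a ha⟩
    have hTU : T = insert a (insert (σ a) U) := by
      rw [hU, Finset.insert_erase hb, Finset.insert_erase ha]
    have haU : a ∉ U := by simp [hU]
    have hbU : σ a ∉ U := by simp [hU]
    have haU' : a ∉ insert (σ a) U := by simp [haU, (hfix a).symm]
    have hUcard : U.card = 2 * m := by
      rw [hU, Finset.card_erase_of_mem hb, Finset.card_erase_of_mem ha]
      omega
    have hUinv : ∀ x ∈ U, σ x ∈ U := by
      intro x hx
      simp only [hU, Finset.mem_erase] at hx ⊢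
      exact ⟨fun h => hx.2.1 (hσ.injective h), fun h => hx.1 (by rw [← h, hσ]), hT x hx.2.2⟩
    have hih := ih U hUinv hUcard
    rw [Finset.card_filter] at hih ⊢
    rw [hTU, Finset.sum_powerset_insert haU', Finset.sum_powerset_insert hbU,
      Finset.sum_powerset_insert hbU]
    have insert_iff : ∀ c, σ c ∉ U → c ∉ U → ∀ S ∈ U.powerset,
        ((∀ x ∈ insert c S, σ x ∉ insert c S) ↔ ∀ x ∈ S, σ x ∉ S) := by
      intro c hc hc' S hS
      rw [Finset.mem_powerset] at hS
      constructor
      · intro h x hx hx'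
        exact h x (Finset.mem_insert_of_mem hx) (Finset.mem_insert_of_mem hx')
      · intro h x hx hx'
        rw [Finset.mem_insert] at hx hx'
        rcases hx with rfl | hx
        · exact hx'.elim (hfix x) (fun h' => hc (hS h'))
        · exact hx'.elim (fun h' => hc (by rw [← h', hσ]; exact hS hx)) (h x hx)
    have insert_insert_not : ∀ S : Finset α,
        ¬ ∀ x ∈ insert a (insert (σ a) S), σ x ∉ insert a (insert (σ a) S) :=
      fun S h => h a (by simp) (by simp)
    have sum_insert : ∀ c, σ c ∉ U → c ∉ U →
        (∑ S ∈ U.powerset, if ∀ x ∈ insert c S, σ x ∉ insert c S then 1 else 0) = 3 ^ m := by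
      intro c hc hc'
      rw [← hih]
      exact Finset.sum_congr rfl fun S hS => if_congr (insert_iff c hc hc' S hS) rfl rfl
    rw [hih, sum_insert a hbU haU, sum_insert (σ a) (by rwa [hσ]) hbU,
      Finset.sum_congr rfl fun S _ => if_neg (insert_insert_not S), Finset.sum_const_zero]
    ring

open Finset
open scoped Pointwise

theorem count_missing_odd_sum (n : ℕ) [NeZero n] (hn : 2 ≤ n) (hne : Even n)
    (k : ZMod n) (hk : ¬ ∃ m : ZMod n, m + m = k) :
    ((Finset.univ : Finset (ZMod n)).powerset.filter
        (fun S => k ∉ S + S)).card = 3 ^ (n / 2) := by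
  rw [← card_filter_powerset_involution_free (σ := fun x => k - x) (fun x => sub_sub_cancel k x)
    (fun x hx => hk ⟨x, (sub_eq_iff_eq_add.mp hx).symm⟩) (n / 2) Finset.univ (by simp)
    (by rw [Finset.card_univ, ZMod.card, Nat.two_mul_div_two_of_even hne])]
  congr 1
  ext S
  simp only [Finset.mem_filter, Finset.mem_add]
  refine and_congr_right fun _ => ⟨fun h x hx hx' => h ⟨x, hx, k - x, hx', add_sub_cancel x k⟩, ?_⟩
  rintro h ⟨x, hx, y, hy, rfl⟩
  exact h x hx (by simpa using hy)
end

section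
/- Let n be odd with n ≥ 1, and let k ∈ ℤ/nℤ. Then the number of subsets S of ℤ/nℤ with k ∉ S + S equals 3^{(n-1)/2}. Equivalently, for a uniformly random subset S of ℤ/nℤ, P(k ∉ S + S) = (1/2) · (3/4)^{(n-1)/2}. -/
open Finset
open scoped Pointwise

/-- A fixed-point-free involution on a set of size `2 * m` has exactly `3 ^ m` subsets that
contain no orbit. -/
theorem card_filter_powerset_of_involutive {α : Type*} [DecidableEq α] {σ : α → α}
    (hσ : Function.Involutive σ) (m : ℕ) (T : Finset α) (hT : ∀ x ∈ T, σ x ∈ T)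
    (hfix : ∀ x ∈ T, σ x ≠ x) (hcard : T.card = 2 * m) :
    (T.powerset.filter (fun S => ∀ x ∈ S, σ x ∉ S)).card = 3 ^ m := by
  induction m generalizing T with
  | zero =>
    obtain rfl : T = ∅ := by simpa using hcard
    simp [Finset.filter_singleton]
  | succ m ih =>
    obtain ⟨a, ha⟩ : T.Nonempty := by
      rw [← Finset.card_pos]
      omega
    have hba : σ a ≠ a := hfix a ha
    have hbT : σ a ∈ T.erase a := Finset.mem_erase.2 ⟨hba, hT a ha⟩
    set U := (T.erase a).erase (σ a) with hU
    have hTU : T = insert a (insert (σ a) U) := by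
      rw [hU, Finset.insert_erase hbT, Finset.insert_erase ha]
    have haU : a ∉ U := by simp [hU]
    have hbU : σ a ∉ U := by simp [hU]
    have hUcard : U.card = 2 * m := by
      rw [hU, Finset.card_erase_of_mem hbT, Finset.card_erase_of_mem ha]
      omega
    have hUT : ∀ x ∈ U, x ∈ T := fun x hx =>
      Finset.mem_of_mem_erase (Finset.mem_of_mem_erase hx)
    have hUσ : ∀ x ∈ U, σ x ∈ U := by
      intro x hx
      refine Finset.mem_erase.2 ⟨fun h => haU ?_, Finset.mem_erase.2 ⟨fun h => hbU ?_, ?_⟩⟩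
      · rwa [← hσ.injective h]
      · rwa [← h, hσ x]
      · exact hT x (hUT x hx)
    have key := ih U hUσ (fun x hx => hfix x (hUT x hx)) hUcard
    have ha' : a ∉ insert (σ a) U := by simp [haU, hba.symm]
    have h1 : ∀ t ∈ U.powerset, (∀ x ∈ insert (σ a) t, σ x ∉ insert (σ a) t) ↔
        ∀ x ∈ t, σ x ∉ t := by
      intro t ht
      rw [Finset.mem_powerset] at ht
      simp only [Finset.mem_insert, not_or, forall_eq_or_imp, hσ a]
      refine ⟨fun h x hx => (h.2 x hx).2, fun h => ⟨⟨hba.symm, fun h' => haU (ht h')⟩,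
        fun x hx => ⟨fun h' => haU (hσ.injective h' ▸ ht hx), h x hx⟩⟩⟩
    have h2 : ∀ t ∈ U.powerset, (∀ x ∈ insert a t, σ x ∉ insert a t) ↔
        ∀ x ∈ t, σ x ∉ t := by
      intro t ht
      rw [Finset.mem_powerset] at ht
      simp only [Finset.mem_insert, not_or, forall_eq_or_imp]
      refine ⟨fun h x hx => (h.2 x hx).2, fun h => ⟨⟨hba, fun h' => hbU (ht h')⟩,
        fun x hx => ⟨fun h' => haU (h' ▸ hUσ x (ht hx)), h x hx⟩⟩⟩
    have h3 : ∀ t ∈ U.powerset, ¬ ∀ x ∈ insert a (insert (σ a) t),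
        σ x ∉ insert a (insert (σ a) t) := by
      intro t _ h
      exact h a (by simp) (by simp)
    rw [Finset.card_filter] at key ⊢
    rw [hTU, Finset.sum_powerset_insert ha', Finset.sum_powerset_insert hbU,
      Finset.sum_powerset_insert hbU,
      Finset.sum_congr rfl fun t ht => if_congr (h1 t ht) rfl rfl,
      Finset.sum_congr rfl fun t ht => if_congr (h2 t ht) rfl rfl,
      Finset.sum_congr rfl fun t ht => if_neg (h3 t ht), key, Finset.sum_const_zero]
    ring

theorem count_missing_sum_odd_n (n : ℕ) [NeZero n] (hn : Odd n) (k : ZMod n) :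
    ((Finset.univ : Finset (ZMod n)).powerset.filter
        (fun S => k ∉ S + S)).card = 3 ^ ((n - 1) / 2) := by
  obtain ⟨m, hm⟩ := hn
  have hzero : (2 * m + 1 : ZMod n) = 0 := by
    have h := ZMod.natCast_self n
    rw [congrArg (Nat.cast (R := ZMod n)) hm] at h
    exact_mod_cast h
  set c : ZMod n := (m + 1) * k with hc
  have hcc : k - c = c := by linear_combination (-k) * hzero
  have huniq : ∀ x : ZMod n, k - x = x → x = c := fun x hx => by
    linear_combination (-(m + 1 : ZMod n)) * hx - x * hzero
  have hσ : Function.Involutive (fun x : ZMod n => k - x) := fun x => sub_sub_cancel k x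
  have hm' : (n - 1) / 2 = m := by omega
  rw [hm', ← card_filter_powerset_of_involutive hσ m (Finset.univ.erase c)]
  · congr 1
    ext S
    simp only [Finset.mem_filter, Finset.mem_powerset, Finset.subset_univ, true_and,
      Finset.subset_erase, Finset.mem_add, not_exists, not_and]
    constructor
    · intro h
      exact ⟨fun h' => h c h' c h' (by linear_combination -hcc),
        fun x hx hx' => h x hx _ hx' (by ring)⟩
    · rintro ⟨-, h⟩ x hx y hy rfl
      exact h x hx (by simpa using hy)
  · intro x hx
    refine Finset.mem_erase.2 ⟨fun h => Finset.ne_of_mem_erase hx ?_, Finset.mem_univ _⟩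
    linear_combination -h + hcc
  · exact fun x hx h => Finset.ne_of_mem_erase hx (huniq x h)
  · rw [Finset.card_erase_of_mem (Finset.mem_univ c), Finset.card_univ, ZMod.card]
    omega
end

section
/- Let n ≥ 1 and let k ∈ ℤ/nℤ. The number of pairs (S₁, S₂) of subsets of ℤ/nℤ with k ∉ S₁ + S₂ equals 3^n. Equivalently, if S₁ and S₂ are independent uniformly random subsets of ℤ/nℤ, then P(k ∉ S₁ + S₂) = (3/4)^n. -/
open Finset
open scoped Pointwise

/-- In a finite additive group `G`, there are `2 ^ (|G| - |S|)` sets `T` such that `k ∉ S + T`. -/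
theorem card_filter_notMem_add {G : Type*} [AddGroup G] [Fintype G] [DecidableEq G]
    (k : G) (S : Finset G) :
    ((Finset.univ : Finset (Finset G)).filter (fun T => k ∉ S + T)).card =
      2 ^ (Fintype.card G - S.card) := by
  have hfilter : (Finset.univ : Finset (Finset G)).filter (fun T => k ∉ S + T) =
      ((S.image (fun x => -x + k))ᶜ).powerset := by
    ext T
    simp only [Finset.mem_filter, Finset.mem_univ, true_and, Finset.mem_powerset,
      Finset.mem_add, not_exists, not_and, Finset.subset_iff, Finset.mem_compl, Finset.mem_image]
    constructor
    · rintro h y hy x hx rfl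
      exact h x hx _ hy (add_neg_cancel_left x k)
    · rintro h x hx y hy rfl
      exact h hy x hx (neg_add_cancel_left x y)
  rw [hfilter, Finset.card_powerset, Finset.card_compl,
    Finset.card_image_of_injective _ fun x y h => neg_injective (add_right_cancel h)]

/-- In a finite additive group `G`, there are `3 ^ |G|` pairs of subsets whose sumset misses a given
element. -/
theorem card_filter_notMem_add_prod {G : Type*} [AddGroup G] [Fintype G] [DecidableEq G] (k : G) :
    ((Finset.univ : Finset (Finset G × Finset G)).filter (fun p => k ∉ p.1 + p.2)).card =
      3 ^ Fintype.card G := by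
  rw [Finset.card_filter, Fintype.sum_prod_type]
  simp only [← Finset.card_filter, card_filter_notMem_add]
  simpa using Fintype.sum_pow_mul_eq_add_pow G (1 : ℕ) 2

theorem count_pairs_missing_sum (n : ℕ) [NeZero n] (k : ZMod n) :
    (((Finset.univ : Finset (ZMod n)).powerset ×ˢ
        (Finset.univ : Finset (ZMod n)).powerset).filter
        (fun p => k ∉ p.1 + p.2)).card = 3 ^ n := by
  simpa only [Finset.powerset_univ, Finset.univ_product_univ, ZMod.card] using
    card_filter_notMem_add_prod k
end

section
/- Let n ≥ 1, let k ∈ ℤ/nℤ, and let d = gcd(k.val, n) (the gcd of the least nonnegative representative of k with n). Then the number of subsets S of ℤ/nℤ with k ∉ S − S equals L(n/d)^d = (F(n/d + 1) + F(n/d − 1))^d, where F is the Fibonacci sequence. Equivalently, for a uniformly random subset S of ℤ/nℤ, P(k ∉ S − S) = L(n/d)^d / 2^n. -/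
open Finset
open scoped Pointwise

/-- Weighted sum over all walks of length `m`, with an extra weight depending on the endpoints. -/
theorem sum_walk_prod_mul {ι R : Type*} [Fintype ι] [DecidableEq ι] [CommSemiring R]
    (M : Matrix ι ι R) (m : ℕ) (g : ι → ι → R) :
    ∑ f : Fin (m + 1) → ι, (∏ i : Fin m, M (f i.castSucc) (f i.succ)) * g (f 0) (f (Fin.last m))
      = ∑ a, ∑ b, (M ^ m) a b * g a b := by
  induction m generalizing g with
  | zero =>
    rw [← (Equiv.funUnique (Fin 1) ι).symm.sum_comp]
    simp [Matrix.one_apply]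
  | succ m ih =>
    rw [← (Fin.consEquiv fun _ : Fin (m + 2) => ι).sum_comp, Fintype.sum_prod_type]
    refine Finset.sum_congr rfl fun a _ => ?_
    have key := ih fun c b => M a c * g a b
    simp only [Fin.consEquiv_apply, Fin.prod_univ_succ, Fin.castSucc_zero, Fin.cons_zero,
      Fin.cons_succ, ← Fin.succ_castSucc, ← Fin.succ_last]
    calc _ = _ := Finset.sum_congr rfl fun f _ => by ring
      _ = _ := key
      _ = _ := by
        rw [Finset.sum_comm]
        refine Finset.sum_congr rfl fun b _ => ?_
        rw [pow_succ', Matrix.mul_apply, Finset.sum_mul]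
        exact Finset.sum_congr rfl fun c _ => by ring

/-- The trace of a matrix power is the weighted sum over closed walks. -/
theorem sum_closed_walk_prod {ι R : Type*} [Fintype ι] [DecidableEq ι] [CommSemiring R]
    (M : Matrix ι ι R) (m : ℕ) [NeZero m] :
    ∑ f : ZMod m → ι, ∏ j, M (f j) (f (j + 1)) = (M ^ m).trace := by
  obtain ⟨m, rfl⟩ := Nat.exists_eq_succ_of_ne_zero (NeZero.ne m)
  change ∑ f : Fin (m + 1) → ι, ∏ j : Fin (m + 1), M (f j) (f (j + 1)) = _
  simp only [Fin.prod_univ_castSucc, Fin.coeSucc_eq_succ, Fin.last_add_one]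
  rw [sum_walk_prod_mul M m fun a b => M b a, Nat.succ_eq_add_one, pow_succ, Matrix.trace]
  simp only [Matrix.diag_apply, Matrix.mul_apply]

/-- A finite commutative group decomposes into cycles under translation by `k`. -/
theorem exists_equiv_quotient_zmultiples_prod {G : Type*} [AddCommGroup G] [Finite G] (k : G) :
    ∃ e : (G ⧸ AddSubgroup.zmultiples k) × ZMod (addOrderOf k) ≃ G,
      ∀ q j, e (q, j + 1) = e (q, j) + k := by
  let φ : ZMod (addOrderOf k) →+ G :=
    ZMod.lift (addOrderOf k) ⟨zmultiplesHom G k, by simp [addOrderOf_nsmul_eq_zero]⟩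
  have hφ (z : ℤ) : φ z = z • k := by simp [φ]
  have hφ_inj : Function.Injective φ := by
    rw [ZMod.lift_injective]
    intro z hz
    rw [ZMod.intCast_zmod_eq_zero_iff_dvd]
    exact addOrderOf_dvd_iff_zsmul_eq_zero.2 (by simpa using hz)
  have hφ_mem (j) : φ j ∈ AddSubgroup.zmultiples k := by
    obtain ⟨z, rfl⟩ := ZMod.intCast_surjective j
    exact ⟨z, (hφ z).symm⟩
  have hmk (q : G ⧸ AddSubgroup.zmultiples k) (j) :
      ((q.out + φ j : G) : G ⧸ AddSubgroup.zmultiples k) = q := by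
    rw [QuotientAddGroup.mk_add_of_mem _ (hφ_mem j), QuotientAddGroup.out_eq']
  refine ⟨Equiv.ofBijective (fun p => p.1.out + φ p.2) ⟨?_, fun x => ?_⟩, fun q j => ?_⟩
  · rintro ⟨q, j⟩ ⟨q', j'⟩ h
    obtain rfl : q = q' := by
      rw [← hmk q j, ← hmk q' j']
      exact congrArg _ h
    exact congrArg _ (hφ_inj (add_left_cancel h))
  · have hx : -(x : G ⧸ AddSubgroup.zmultiples k).out + x ∈ AddSubgroup.zmultiples k :=
      QuotientAddGroup.eq.1 (QuotientAddGroup.out_eq' _)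
    obtain ⟨z, hz⟩ := hx
    refine ⟨(x, z), ?_⟩
    change (x : G ⧸ AddSubgroup.zmultiples k).out + φ z = x
    rw [hφ, show z • k = _ from hz, add_neg_cancel_left]
  · have h1 : φ 1 = k := by simpa using hφ 1
    change q.out + φ (j + 1) = q.out + φ j + k
    rw [map_add, h1, add_assoc]

theorem sum_prod_translate {ι R G : Type*} [Fintype ι] [DecidableEq ι] [CommSemiring R]
    [AddCommGroup G] [Fintype G] [DecidableEq G] (M : Matrix ι ι R) (k : G) :
    ∑ f : G → ι, ∏ x, M (f x) (f (x + k))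
      = (M ^ addOrderOf k).trace ^ Nat.card (G ⧸ AddSubgroup.zmultiples k) := by
  classical
  have : NeZero (addOrderOf k) := ⟨(addOrderOf_pos k).ne'⟩
  have := Fintype.ofFinite (G ⧸ AddSubgroup.zmultiples k)
  obtain ⟨e, he⟩ := exists_equiv_quotient_zmultiples_prod k
  rw [← sum_closed_walk_prod, Nat.card_eq_fintype_card, ← Finset.card_univ, ← Finset.prod_const,
    Finset.prod_univ_sum, Fintype.piFinset_univ,
    ← ((Equiv.curry _ _ ι).symm.trans (e.arrowCongr (Equiv.refl ι))).sum_comp]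
  refine Finset.sum_congr rfl fun f _ => ?_
  rw [← e.prod_comp, Fintype.prod_prod_type]
  simp [← he, Function.uncurry]

/-- The transfer matrix of binary words without two consecutive `true`s. -/
def goldenMatrix : Matrix Bool Bool ℕ :=
  Matrix.of fun a b => if a ∧ b then 0 else 1

theorem goldenMatrix_pow_succ (m : ℕ) :
    goldenMatrix ^ (m + 1) = Matrix.of fun a b => Nat.fib (m + 2 - a.toNat - b.toNat) := by
  induction m with
  | zero => ext a b; cases a <;> cases b <;> simp [goldenMatrix]
  | succ m ih =>
    ext a b
    rw [pow_succ, ih, Matrix.mul_apply]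
    have h2 := Nat.fib_add_two (n := m)
    have h3 := Nat.fib_add_two (n := m + 1)
    cases a <;> cases b <;> simp [goldenMatrix] <;> grind

theorem trace_goldenMatrix_pow {m : ℕ} (hm : m ≠ 0) :
    (goldenMatrix ^ m).trace = Nat.fib (m + 1) + Nat.fib (m - 1) := by
  obtain ⟨m, rfl⟩ := Nat.exists_eq_succ_of_ne_zero hm
  rw [Nat.succ_eq_add_one, goldenMatrix_pow_succ]
  simp [Matrix.trace, add_comm (Nat.fib m)]

theorem card_filter_notMem_sub_self {G : Type*} [AddCommGroup G] [Fintype G] [DecidableEq G]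
    (k : G) :
    ((Finset.univ : Finset G).powerset.filter fun S => k ∉ S - S).card
      = ∑ f : G → Bool, ∏ x, goldenMatrix (f x) (f (x + k)) := by
  have hM (f : G → Bool) : ∏ x, goldenMatrix (f x) (f (x + k))
      = if ∀ x, ¬(f x ∧ f (x + k)) then 1 else 0 := by
    simp only [goldenMatrix, Matrix.of_apply, ← ite_not (_ ∧ _), Finset.prod_ite_zero, Finset.prod_const_one,
      Finset.mem_univ, true_imp_iff]
  simp only [hM, Finset.sum_boole, Nat.cast_id]
  refine Finset.card_bij' (fun S _ x => decide (x ∈ S)) (fun f _ => Finset.univ.filter fun x => f x) ?_ ?_ ?_ ?_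
  · intro S hS
    simp only [Finset.mem_filter, Finset.mem_univ, true_and, decide_eq_true_eq] at hS ⊢
    exact fun x hx => hS.2 (Finset.mem_sub.2 ⟨_, hx.2, _, hx.1, add_sub_cancel_left x k⟩)
  · intro f hf
    simp only [Finset.mem_filter, Finset.mem_univ, true_and, Finset.mem_powerset,
      Finset.subset_univ, Finset.mem_sub, not_exists, not_and] at hf ⊢
    intro y hy x hx h
    exact hf x hx (by rwa [← h, add_sub_cancel])
  · intro S _
    simp
  · intro f _
    simp

theorem count_missing_diff_zmod (n : ℕ) [NeZero n] (k : ZMod n)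
    (d : ℕ) (hd : d = Nat.gcd k.val n) :
    ((Finset.univ : Finset (ZMod n)).powerset.filter
        (fun S => k ∉ S - S)).card
      = (Nat.fib (n / d + 1) + Nat.fib (n / d - 1)) ^ d := by
  have hn : 0 < n := NeZero.pos n
  have hdn : d ∣ n := hd ▸ Nat.gcd_dvd_right _ _
  have hord : addOrderOf k = n / d := by
    rw [hd, Nat.gcd_comm, ← ZMod.addOrderOf_coe _ hn.ne', ZMod.natCast_zmod_val]
  have hpos : 0 < n / d := hord ▸ addOrderOf_pos k
  have hcard : Nat.card (ZMod n ⧸ AddSubgroup.zmultiples k) = d := by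
    have h := AddSubgroup.card_eq_card_quotient_mul_card_addSubgroup (AddSubgroup.zmultiples k)
    rw [Nat.card_zmultiples, hord, Nat.card_zmod] at h
    exact Nat.eq_of_mul_eq_mul_right hpos (by rw [← h, Nat.mul_div_cancel' hdn])
  rw [card_filter_notMem_sub_self, sum_prod_translate, hord, hcard,
    trace_goldenMatrix_pow hpos.ne']
end

section
/- Let S be a uniformly random subset of ℤ/nℤ. Then P(|S + S| = |S − S| = n) → 1 as n → ∞. Formally: the ratio (number of finsets S of ZMod n with S + S = Finset.univ and S − S = Finset.univ) / 2^n tends to 1 as n → ∞. -/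
open Finset Filter
open scoped Pointwise

section Counting

variable {G : Type*} [Fintype G] [DecidableEq G]

/-- The subsets `S` that contain no pair `{x, f x}` with `x ∈ W`. -/
def pairAvoiding (f : Equiv.Perm G) (W : Finset G) : Finset (Finset G) :=
  univ.filter fun S => ∀ x ∈ W, ¬(x ∈ S ∧ f x ∈ S)

theorem mem_pairAvoiding {f : Equiv.Perm G} {W S : Finset G} :
    S ∈ pairAvoiding f W ↔ ∀ x ∈ W, ¬(x ∈ S ∧ f x ∈ S) := by
  simp [pairAvoiding]

theorem pairAvoiding_anti (f : Equiv.Perm G) {V W : Finset G} (h : V ⊆ W) :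
    pairAvoiding f W ⊆ pairAvoiding f V := fun _ hS =>
  mem_pairAvoiding.2 fun x hx => mem_pairAvoiding.1 hS x (h hx)

/-- Imposing a constraint disjoint from the previous ones costs a factor of at least `3 / 4`. -/
theorem card_pairAvoiding_insert (f : Equiv.Perm G) {V : Finset G} {x : G}
    (h₁ : x ∉ V) (h₂ : f x ∉ V) (h₃ : f.symm x ∉ V) :
    (pairAvoiding f (insert x V)).card * 4 ≤ 3 * (pairAvoiding f V).card := by
  set T := (pairAvoiding f V).filter fun S => x ∈ S ∧ f x ∈ S with hT
  have hsplit : T.card + (pairAvoiding f (insert x V)).card = (pairAvoiding f V).card := by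
    rw [← card_filter_add_card_filter_not (s := pairAvoiding f V)
      (fun S => x ∈ S ∧ f x ∈ S)]
    congr 2
    ext S
    simp only [mem_pairAvoiding, mem_filter, forall_mem_insert]
    tauto
  have hle : (pairAvoiding f V).card ≤ (T ×ˢ (univ : Finset (Bool × Bool))).card := by
    refine card_le_card_of_injOn
      (fun S => (insert x (insert (f x) S), (decide (x ∈ S), decide (f x ∈ S)))) ?_ ?_
    · intro S hS
      have hS' := mem_pairAvoiding.1 hS
      simp only [hT, coe_product, Set.mem_prod, mem_coe, mem_filter, mem_pairAvoiding, mem_univ,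
        and_true, mem_insert, true_or, or_true]
      intro y hy
      have e₁ : y ≠ x := fun e => h₁ (e ▸ hy)
      have e₂ : y ≠ f x := fun e => h₂ (e ▸ hy)
      have e₃ : f y ≠ x := fun e => h₃ (by rwa [← e, Equiv.symm_apply_apply])
      have e₄ : f y ≠ f x := fun e => e₁ (f.injective e)
      simpa [e₁, e₂, e₃, e₄] using hS' y hy
    · intro S _ S' _ h
      simp only [Prod.mk.injEq, decide_eq_decide] at h
      obtain ⟨h, hx, hfx⟩ := h
      ext y
      have := congrArg (y ∈ ·) h
      simp only [mem_insert, eq_iff_iff] at this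
      by_cases e : y = x
      · rwa [e]
      by_cases e' : y = f x
      · rwa [e']
      simpa [e, e'] using this
  rw [card_product, card_univ, Fintype.card_prod, Fintype.card_bool] at hle
  omega

theorem card_pairAvoiding_le (f : Equiv.Perm G) (m : ℕ) (W : Finset G) (hW : 3 * m ≤ W.card) :
    (pairAvoiding f W).card * 4 ^ m ≤ 3 ^ m * 2 ^ Fintype.card G := by
  induction m generalizing W with
  | zero => simpa using card_le_univ (pairAvoiding f W)
  | succ m ih =>
    obtain ⟨x, hx⟩ : W.Nonempty := card_pos.1 (by omega)
    obtain ⟨V, hV⟩ : ∃ V, V = W \ {x, f x, f.symm x} := ⟨_, rfl⟩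
    have hcard : 3 * m ≤ V.card := by
      have := le_card_sdiff {x, f x, f.symm x} W
      rw [← hV] at this
      have := card_le_three (a := x) (b := f x) (c := f.symm x)
      omega
    have hsub : insert x V ⊆ W := insert_subset hx (hV ▸ sdiff_subset)
    have hins := card_pairAvoiding_insert f (V := V) (x := x)
      (by simp [hV]) (by simp [hV]) (by simp [hV])
    calc (pairAvoiding f W).card * 4 ^ (m + 1)
        ≤ (pairAvoiding f (insert x V)).card * 4 ^ (m + 1) := by
          gcongr; exact pairAvoiding_anti f hsub
      _ = (pairAvoiding f (insert x V)).card * 4 * 4 ^ m := by ring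
      _ ≤ 3 * (pairAvoiding f V).card * 4 ^ m := by gcongr
      _ = 3 * ((pairAvoiding f V).card * 4 ^ m) := by ring
      _ ≤ 3 * (3 ^ m * 2 ^ Fintype.card G) := Nat.mul_le_mul_left 3 (ih V hcard)
      _ = 3 ^ (m + 1) * 2 ^ Fintype.card G := by ring

theorem card_pairAvoiding_univ_le (f : Equiv.Perm G) :
    ((pairAvoiding f univ).card : ℝ) ≤
      (3 / 4) ^ (Fintype.card G / 3) * 2 ^ Fintype.card G := by
  have h := card_pairAvoiding_le f (Fintype.card G / 3) univ (by rw [card_univ]; omega)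
  rw [div_pow, div_mul_eq_mul_div, le_div_iff₀ (by positivity)]
  exact_mod_cast h

variable [AddCommGroup G]

theorem add_self_ne_univ_or_sub_self_ne_univ_subset :
    (univ.filter fun S : Finset G => ¬(S + S = univ ∧ S - S = univ)) ⊆
      univ.biUnion fun k : G =>
        pairAvoiding (Equiv.subLeft k) univ ∪ pairAvoiding (Equiv.subRight k) univ := by
  intro S hS
  simp only [mem_filter, mem_univ, true_and, eq_univ_iff_forall, not_and_or, not_forall] at hS
  simp only [mem_biUnion, mem_univ, true_and, mem_union, mem_pairAvoiding, Equiv.subLeft_apply,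
    Equiv.subRight_apply, forall_true_left]
  rcases hS with ⟨k, hk⟩ | ⟨k, hk⟩
  · exact ⟨k, Or.inl fun x hx => hk (mem_add.2 ⟨x, hx.1, k - x, hx.2, by abel⟩)⟩
  · exact ⟨k, Or.inr fun x hx => hk (mem_sub.2 ⟨x, hx.1, x - k, hx.2, by abel⟩)⟩

theorem card_not_add_self_and_sub_self_eq_univ_le :
    ((univ.filter fun S : Finset G => ¬(S + S = univ ∧ S - S = univ)).card : ℝ) ≤
      2 * Fintype.card G * (3 / 4) ^ (Fintype.card G / 3) * 2 ^ Fintype.card G := by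
  calc ((univ.filter fun S : Finset G => ¬(S + S = univ ∧ S - S = univ)).card : ℝ)
      ≤ ∑ k : G, (((pairAvoiding (Equiv.subLeft k) univ).card : ℝ) +
          (pairAvoiding (Equiv.subRight k) univ).card) := by
        exact_mod_cast (card_le_card add_self_ne_univ_or_sub_self_ne_univ_subset).trans
          (card_biUnion_le.trans (sum_le_sum fun k _ => card_union_le _ _))
    _ ≤ ∑ _k : G, ((3 / 4) ^ (Fintype.card G / 3) * 2 ^ Fintype.card G +
          (3 / 4) ^ (Fintype.card G / 3) * 2 ^ Fintype.card G : ℝ) :=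
        sum_le_sum fun k _ =>
          add_le_add (card_pairAvoiding_univ_le _) (card_pairAvoiding_univ_le _)
    _ = _ := by
        rw [sum_const, card_univ, nsmul_eq_mul]; ring

theorem one_sub_le_card_add_self_and_sub_self_eq_univ_div :
    1 - 6 * ((Fintype.card G / 3 : ℕ) + 1) * (3 / 4 : ℝ) ^ (Fintype.card G / 3) ≤
      ((univ.filter fun S : Finset G => S + S = univ ∧ S - S = univ).card : ℝ) /
        2 ^ Fintype.card G := by
  have hbad := card_not_add_self_and_sub_self_eq_univ_le (G := G)
  have htotal : ((univ.filter fun S : Finset G => S + S = univ ∧ S - S = univ).card : ℝ) +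
      (univ.filter fun S : Finset G => ¬(S + S = univ ∧ S - S = univ)).card =
        2 ^ Fintype.card G := by
    have h := card_filter_add_card_filter_not (s := (univ : Finset (Finset G)))
      (fun S => S + S = univ ∧ S - S = univ)
    rw [card_univ, Fintype.card_finset] at h
    exact_mod_cast h
  have hN : (Fintype.card G : ℝ) ≤ 3 * ((Fintype.card G / 3 : ℕ) + 1) := by
    have : Fintype.card G ≤ 3 * (Fintype.card G / 3 + 1) := by omega
    exact_mod_cast this
  have hmul : 2 * Fintype.card G * (3 / 4 : ℝ) ^ (Fintype.card G / 3) * 2 ^ Fintype.card G ≤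
      6 * ((Fintype.card G / 3 : ℕ) + 1) * (3 / 4 : ℝ) ^ (Fintype.card G / 3) *
        2 ^ Fintype.card G := by
    have : (2 : ℝ) * Fintype.card G ≤ 6 * ((Fintype.card G / 3 : ℕ) + 1) := by linarith
    exact mul_le_mul_of_nonneg_right (mul_le_mul_of_nonneg_right this (by positivity))
      (by positivity)
  rw [le_div_iff₀ (by positivity), sub_mul, one_mul]
  linarith

end Counting

theorem zmod_most_subsets_balanced :
    Tendsto
      (fun n : ℕ =>
        (((Finset.univ : Finset (ZMod (n + 1))).powerset.filter
            (fun S => S + S = Finset.univ ∧ S - S = Finset.univ)).card : ℝ)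
          / 2 ^ (n + 1))
      atTop (nhds 1) := by
  have hgeom : Tendsto (fun m : ℕ => 1 - 6 * ((m : ℝ) + 1) * (3 / 4 : ℝ) ^ m) atTop (nhds 1) := by
    have h₁ := tendsto_self_mul_const_pow_of_lt_one (r := (3 / 4 : ℝ)) (by norm_num) (by norm_num)
    have h₂ := tendsto_pow_atTop_nhds_zero_of_lt_one (r := (3 / 4 : ℝ)) (by norm_num) (by norm_num)
    have h := ((h₁.add h₂).const_mul 6).const_sub 1
    norm_num only at h
    exact h.congr fun m => by ring
  have hdiv : Tendsto (fun n : ℕ => (n + 1) / 3) atTop atTop :=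
    (Nat.tendsto_div_const_atTop (by norm_num)).comp (tendsto_add_atTop_nat 1)
  refine tendsto_of_tendsto_of_tendsto_of_le_of_le (hgeom.comp hdiv) tendsto_const_nhds ?_ ?_
  · intro n
    simpa only [powerset_univ, ZMod.card, Function.comp_apply] using
      one_sub_le_card_add_self_and_sub_self_eq_univ_div (G := ZMod (n + 1))
  · intro n
    refine div_le_one_of_le₀ ?_ (by positivity)
    have h : (univ : Finset (ZMod (n + 1))).powerset.card = 2 ^ (n + 1) := by
      rw [card_powerset, card_univ, ZMod.card]
    calc _ ≤ ((univ : Finset (ZMod (n + 1))).powerset.card : ℝ) :=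
          Nat.cast_le.2 (card_filter_le _ _)
      _ = 2 ^ (n + 1) := by rw [h]; norm_cast
end

section
/- Let n ≥ 1, let D_{2n} be the dihedral group of order 2n, and let k = r^i be a rotation element. For a uniformly random subset S of D_{2n}, P(k ∉ S·S^{-1}) ≤ (9/10)^{2n}. Formally: for i : ZMod n, ((Finset.univ.powerset.filter (fun S => DihedralGroup.r i ∉ S / S)).card : ℝ) / 2^(2n) ≤ (9/10)^(2n). (The paper states the bound as (φ/2)^{2n} with φ the golden ratio, noting that 1.8 ≥ φ is used as a crude bound so that the inequality with base 9/10 = 1.8/2 holds for all n.) -/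
open Finset
open scoped Pointwise

section DiffAvoiding

variable {G : Type*} [Group G] [DecidableEq G]

/-- The subsets of `A` whose difference set does not contain `k`. -/
def diffAvoiding (k : G) (A : Finset G) : Finset (Finset G) :=
  A.powerset.filter (fun S => k ∉ S / S)

theorem mem_diffAvoiding {k : G} {A S : Finset G} :
    S ∈ diffAvoiding k A ↔ S ⊆ A ∧ k ∉ S / S := by
  simp [diffAvoiding]

theorem card_diffAvoiding_union_le (k : G) (A B : Finset G) :
    #(diffAvoiding k (A ∪ B)) ≤ #(diffAvoiding k A) * #(diffAvoiding k B) := by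
  rw [← card_product]
  refine card_le_card_of_injOn (fun S => (S ∩ A, S ∩ B)) ?_ ?_
  · intro S hS
    have h := (mem_diffAvoiding.1 (mem_coe.1 hS)).2
    exact mem_coe.2 (mem_product.2
      ⟨mem_diffAvoiding.2 ⟨inter_subset_right,
          fun hk => h (div_subset_div inter_subset_left inter_subset_left hk)⟩,
        mem_diffAvoiding.2 ⟨inter_subset_right,
          fun hk => h (div_subset_div inter_subset_left inter_subset_left hk)⟩⟩)
  · intro S hS T hT hST
    obtain ⟨h₁, h₂⟩ := Prod.mk.inj hST
    rw [← inter_eq_left.2 (mem_diffAvoiding.1 (mem_coe.1 hS)).1,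
      ← inter_eq_left.2 (mem_diffAvoiding.1 (mem_coe.1 hT)).1,
      inter_union_distrib_left, inter_union_distrib_left, h₁, h₂]

theorem mul_notMem_of_notMem_div {k x : G} {S : Finset G} (hS : k ∉ S / S) (hx : x ∈ S) :
    k * x ∉ S :=
  fun hkx => hS (mem_div.2 ⟨k * x, hkx, x, hx, by simp⟩)

theorem card_diffAvoiding_pair_le (k x : G) : #(diffAvoiding k {x, k * x}) ≤ 3 := by
  have hsub : diffAvoiding k {x, k * x} ⊆ {∅, {x}, {k * x}} := by
    intro S hS
    obtain ⟨hS, hk⟩ := mem_diffAvoiding.1 hS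
    have h := mul_notMem_of_notMem_div hk (x := x)
    simp only [subset_iff, mem_insert, mem_singleton] at hS
    simp only [mem_insert, mem_singleton, Finset.ext_iff, notMem_empty]
    by_cases h₁ : x ∈ S <;> by_cases h₂ : k * x ∈ S <;> grind
  exact (card_le_card hsub).trans card_le_three

theorem card_diffAvoiding_triple_le (k x : G) :
    #(diffAvoiding k {x, k * x, k * (k * x)}) ≤ 5 := by
  have hsub : diffAvoiding k {x, k * x, k * (k * x)} ⊆
      {∅, {x}, {k * x}, {k * (k * x)}, {x, k * (k * x)}} := by
    intro S hS
    obtain ⟨hS, hk⟩ := mem_diffAvoiding.1 hS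
    have h := mul_notMem_of_notMem_div hk (x := x)
    have h' := mul_notMem_of_notMem_div hk (x := k * x)
    simp only [subset_iff, mem_insert, mem_singleton] at hS
    simp only [mem_insert, mem_singleton, Finset.ext_iff, notMem_empty]
    by_cases h₁ : x ∈ S <;> by_cases h₂ : k * x ∈ S <;> by_cases h₃ : k * (k * x) ∈ S <;> grind
  exact (card_le_card hsub).trans card_le_five

theorem card_diffAvoiding_image_pow_mul_le (k x : G) (m : ℕ) :
    (#(diffAvoiding k ((range (m + 2)).image (fun j => k ^ j * x))) : ℝ)
      ≤ (9 / 5 : ℝ) ^ (m + 2) := by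
  induction m using Nat.twoStepInduction with
  | zero =>
    have h := card_diffAvoiding_pair_le k x
    have e : (range (0 + 2)).image (fun j => k ^ j * x) = {x, k * x} := by
      ext y; simp [range_add_one, or_comm]
    rw [e]
    have : (#(diffAvoiding k {x, k * x}) : ℝ) ≤ 3 := by exact_mod_cast h
    norm_num; linarith
  | one =>
    have h := card_diffAvoiding_triple_le k x
    have e : (range (1 + 2)).image (fun j => k ^ j * x) = {x, k * x, k * (k * x)} := by
      ext y; simp [range_add_one, pow_succ, mul_assoc]; tauto
    rw [e]
    have : (#(diffAvoiding k {x, k * x, k * (k * x)}) : ℝ) ≤ 5 := by exact_mod_cast h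
    norm_num; linarith
  | more m ih _ =>
    have e : (range (m + 2 + 2)).image (fun j => k ^ j * x) =
        (range (m + 2)).image (fun j => k ^ j * x) ∪
          {k ^ (m + 2) * x, k * (k ^ (m + 2) * x)} := by
      rw [range_add_one, range_add_one (n := m + 2), image_insert, image_insert, ← mul_assoc,
        ← pow_succ']
      ext y
      simp only [mem_insert, mem_union, mem_singleton]
      tauto
    have h₁ : (#(diffAvoiding k ((range (m + 2 + 2)).image (fun j => k ^ j * x))) : ℝ) ≤
        #(diffAvoiding k ((range (m + 2)).image (fun j => k ^ j * x))) *
          #(diffAvoiding k {k ^ (m + 2) * x, k * (k ^ (m + 2) * x)}) := by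
      rw [e]
      exact_mod_cast card_diffAvoiding_union_le k _ _
    have h₂ : (#(diffAvoiding k {k ^ (m + 2) * x, k * (k ^ (m + 2) * x)}) : ℝ) ≤ (9 / 5) ^ 2 :=
      le_trans (b := (3 : ℝ)) (by exact_mod_cast card_diffAvoiding_pair_le k _) (by norm_num)
    rw [pow_add _ (m + 2) 2]
    exact h₁.trans (mul_le_mul ih h₂ (by positivity) (by positivity))

/-- The bound for sets invariant under left multiplication by an element of finite order,
obtained by removing one right coset of the subgroup generated by `k` at a time. -/
theorem card_diffAvoiding_le_of_mul_mem {k : G} (hk : k ≠ 1) (hfin : IsOfFinOrder k)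
    (A : Finset G) (hA : ∀ y, k * y ∈ A ↔ y ∈ A) :
    (#(diffAvoiding k A) : ℝ) ≤ (9 / 5 : ℝ) ^ #A := by
  induction A using Finset.strongInduction with
  | H A ih =>
    rcases A.eq_empty_or_nonempty with rfl | ⟨x, hx⟩
    · simpa [diffAvoiding] using card_filter_le ({∅} : Finset (Finset G)) (fun S => k ∉ S / S)
    set C := (range (orderOf k)).image (fun j => k ^ j * x) with hC
    have hpow : ∀ j : ℕ, k ^ j * x ∈ A := by
      intro j
      induction j with
      | zero => simpa using hx
      | succ j hj => rwa [pow_succ', mul_assoc, hA]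
    have hCA : C ⊆ A := by
      intro y hy
      obtain ⟨j, -, rfl⟩ := mem_image.1 hy
      exact hpow j
    have hpos := hfin.orderOf_pos
    have hmemC : ∀ y, y ∈ C ↔ y * x⁻¹ ∈ Subgroup.zpowers k := by
      intro y
      rw [hfin.mem_zpowers_iff_mem_range_orderOf, hC, mem_image, mem_image]
      simp only [eq_mul_inv_iff_mul_eq]
    have hCinv : ∀ y, k * y ∈ C ↔ y ∈ C := by
      intro y
      rw [hmemC, hmemC, mul_assoc, Subgroup.mul_mem_cancel_left _ (Subgroup.mem_zpowers k)]
    have hxC : x ∈ C := mem_image.2 ⟨0, mem_range.2 hpos, by simp⟩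
    have hcard : #C = orderOf k := by
      rw [hC, card_image_of_injOn, card_range]
      intro a ha b hb hab
      exact pow_injOn_Iio_orderOf (by simpa using ha) (by simpa using hb) (mul_right_cancel hab)
    have hC_le : (#(diffAvoiding k C) : ℝ) ≤ (9 / 5) ^ #C := by
      have h1 : orderOf k ≠ 1 := fun h => hk (orderOf_eq_one_iff.1 h)
      obtain ⟨m, hm⟩ := Nat.exists_eq_add_of_le' (show 2 ≤ orderOf k by omega)
      rw [hcard, hC, hm]
      exact card_diffAvoiding_image_pow_mul_le k x m
    have hrest := ih (A \ C) (sdiff_ssubset hCA ⟨x, hxC⟩)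
      (fun y => by rw [mem_sdiff, mem_sdiff, hA, hCinv])
    have hunion : (#(diffAvoiding k A) : ℝ) ≤
        #(diffAvoiding k C) * #(diffAvoiding k (A \ C)) := by
      conv_lhs => rw [← union_sdiff_of_subset hCA]
      exact_mod_cast card_diffAvoiding_union_le k _ _
    calc (#(diffAvoiding k A) : ℝ)
        ≤ (9 / 5) ^ #C * (9 / 5) ^ #(A \ C) :=
          hunion.trans (mul_le_mul hC_le hrest (by positivity) (by positivity))
      _ = (9 / 5) ^ #A := by
          rw [← pow_add, add_comm, card_sdiff_add_card_eq_card hCA]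

theorem diffAvoiding_one (A : Finset G) : diffAvoiding 1 A = {∅} := by
  ext S
  rw [mem_diffAvoiding, one_mem_div_iff, not_not, disjoint_self_iff_empty, mem_singleton]
  exact ⟨And.right, fun h => ⟨h ▸ empty_subset A, h⟩⟩

theorem card_diffAvoiding_univ_le [Fintype G] (k : G) :
    (#(diffAvoiding k univ) : ℝ) ≤ (9 / 5 : ℝ) ^ Fintype.card G := by
  by_cases hk : k = 1
  · rw [hk, diffAvoiding_one, card_singleton, Nat.cast_one]
    exact one_le_pow₀ (by norm_num)
  · exact card_diffAvoiding_le_of_mul_mem hk (isOfFinOrder_of_finite k) univ (by simp)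

end DiffAvoiding

theorem dihedral_rotation_not_in_diffset (n : ℕ) [NeZero n] (i : ZMod n) :
    (((Finset.univ : Finset (DihedralGroup n)).powerset.filter
        (fun S => DihedralGroup.r i ∉ S / S)).card : ℝ) / 2 ^ (2 * n)
      ≤ ((9 : ℝ) / 10) ^ (2 * n) := by
  rw [div_le_iff₀ (by positivity), ← mul_pow]
  have h := card_diffAvoiding_univ_le (DihedralGroup.r i)
  rw [DihedralGroup.card] at h
  norm_num
  exact h
end

section
/- Let n ≥ 1, let D_{2n} be the dihedral group of order 2n, and let k = r^i·s be a reflection element. For a uniformly random subset S of D_{2n}, P(k ∉ S·S) ≤ (3/4)^n. Formally: for i : ZMod n, ((Finset.univ.powerset.filter (fun S => DihedralGroup.sr i ∉ S * S)).card : ℝ) / 2^(2n) ≤ (3/4)^n. -/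
open Finset
open scoped Pointwise

/-- The reflection `sr i` is the product `sr j * r (i - j)` for every `j`, so a set whose square
avoids `sr i` misses an element of each of the `n` disjoint pairs `{sr j, r (i - j)}`. -/
theorem card_filter_sr_notMem_mul_self_le (n : ℕ) [NeZero n] (i : ZMod n) :
    ((Finset.univ : Finset (DihedralGroup n)).powerset.filter
        (fun S => DihedralGroup.sr i ∉ S * S)).card ≤ 3 ^ n := by
  let pairs : Finset (ZMod n → Bool × Bool) :=
    Fintype.piFinset fun _ => Finset.univ.erase (true, true)
  have card_pairs : pairs.card = 3 ^ n := by
    simp [pairs, Fintype.card_piFinset, ZMod.card]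
  rw [← card_pairs]
  refine Finset.card_le_card_of_injOn
    (fun S j => (decide (DihedralGroup.sr j ∈ S), decide (DihedralGroup.r (i - j) ∈ S))) ?_ ?_
  · intro S hS
    have hS' : DihedralGroup.sr i ∉ S * S := (Finset.mem_filter.mp hS).2
    refine Fintype.mem_piFinset.mpr fun j => Finset.mem_erase.mpr ⟨fun h => hS' ?_, mem_univ _⟩
    simp only [Prod.mk.injEq, decide_eq_true_eq] at h
    simpa using Finset.mul_mem_mul h.1 h.2
  · intro S _ T _ h
    have mem_iff (j : ZMod n) : (DihedralGroup.sr j ∈ S ↔ DihedralGroup.sr j ∈ T) ∧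
        (DihedralGroup.r (i - j) ∈ S ↔ DihedralGroup.r (i - j) ∈ T) := by
      simpa using congrFun h j
    ext (j | j)
    · simpa using (mem_iff (i - j)).2
    · exact (mem_iff j).1

theorem dihedral_reflection_not_in_sumset (n : ℕ) [NeZero n] (i : ZMod n) :
    (((Finset.univ : Finset (DihedralGroup n)).powerset.filter
        (fun S => DihedralGroup.sr i ∉ S * S)).card : ℝ) / 2 ^ (2 * n)
      ≤ ((3 : ℝ) / 4) ^ n := by
  rw [div_pow, pow_mul, show (2 : ℝ) ^ 2 = 4 by norm_num]
  gcongr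
  exact_mod_cast card_filter_sr_notMem_mul_self_le n i
end

section
/- Let n ≥ 1, let D_{2n} be the dihedral group of order 2n, and let k = r^i·s be a reflection element. For a uniformly random subset S of D_{2n}, P(k ∉ S·S^{-1}) ≤ (3/4)^n. Formally: for i : ZMod n, ((Finset.univ.powerset.filter (fun S => DihedralGroup.sr i ∉ S / S)).card : ℝ) / 2^(2n) ≤ (3/4)^n. -/
open Finset
open scoped Pointwise

/-- A subset whose difference set avoids `sr i` contains at most one element of each pair
`{r a, sr (i + a)}`, hence is encoded by a ternary word indexed by `a : ZMod n`. -/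
theorem card_filter_sr_notMem_div_le (n : ℕ) [NeZero n] (i : ZMod n) :
    ((Finset.univ : Finset (DihedralGroup n)).powerset.filter
        (fun S => DihedralGroup.sr i ∉ S / S)).card ≤ 3 ^ n := by
  have hcard : (Finset.univ : Finset (ZMod n → Fin 3)).card = 3 ^ n := by
    simp [ZMod.card]
  rw [← hcard]
  refine Finset.card_le_card_of_injOn
    (fun S a => if DihedralGroup.r a ∈ S then 0
      else if DihedralGroup.sr (i + a) ∈ S then 1 else 2) (fun _ _ => by simp) ?_
  have disjoint_pair (S : Finset (DihedralGroup n)) (hS : DihedralGroup.sr i ∉ S / S)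
      (a : ZMod n) (hr : DihedralGroup.r a ∈ S) : DihedralGroup.sr (i + a) ∉ S := by
    intro hs
    refine hS (Finset.mem_div.2 ⟨_, hs, _, hr, ?_⟩)
    simp [div_eq_mul_inv]
  intro S hS T hT hST
  replace hS := disjoint_pair S (Finset.mem_filter.1 hS).2
  replace hT := disjoint_pair T (Finset.mem_filter.1 hT).2
  have hpair (a : ZMod n) : (DihedralGroup.r a ∈ S ↔ DihedralGroup.r a ∈ T) ∧
      (DihedralGroup.sr (i + a) ∈ S ↔ DihedralGroup.sr (i + a) ∈ T) := by
    have h := congrFun hST a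
    have hSa := hS a
    have hTa := hT a
    dsimp only at h
    split_ifs at h <;> simp_all
  ext x
  cases x with
  | r a => exact (hpair a).1
  | sr b => simpa using (hpair (b - i)).2

theorem dihedral_reflection_not_in_diffset (n : ℕ) [NeZero n] (i : ZMod n) :
    (((Finset.univ : Finset (DihedralGroup n)).powerset.filter
        (fun S => DihedralGroup.sr i ∉ S / S)).card : ℝ) / 2 ^ (2 * n)
      ≤ ((3 : ℝ) / 4) ^ n := by
  have hpow : (2 : ℝ) ^ (2 * n) = 4 ^ n := by
    rw [pow_mul]
    norm_num
  rw [hpow, div_pow]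
  gcongr
  exact_mod_cast card_filter_sr_notMem_div_le n i
end
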